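/- arXiv:2104.07482 — 3 statements merged into one kernel-verified Lean document; each statement's English description precedes it below -/
import Mathlib

section
/- Let μ be a Radon measure on ℝ^d admitting (p,q) Fourier restriction. Then μ is absolutely continuous with respect to the Hausdorff measure H^{dq/p'}. -/
open MeasureTheory Metric Filter
open scoped FourierTransform ENNReal SchwartzMap

noncomputable section

/-- `ℝ^d` as a Euclidean space. -/
abbrev Euc (d : ℕ) := EuclideanSpace ℝ (Fin d)

/-- The measure `μ` admits `(p,q)` Fourier restriction with constant `C`:
`‖f̂‖_{L^q(μ)} ≤ C ‖f‖_{L^p(ℝ^d)}` for all Schwartz functions `f`. -/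
def HasRestriction {d : ℕ} (μ : Measure (Euc d)) (p q C : ℝ) : Prop :=
  ∀ f : 𝓢(Euc d, ℂ),
    eLpNorm (𝓕 (f : Euc d → ℂ)) (ENNReal.ofReal q) μ ≤
      ENNReal.ofReal C * eLpNorm (f : Euc d → ℂ) (ENNReal.ofReal p) volume

open Module Topology

section
variable {V : Type*} [NormedAddCommGroup V] [InnerProductSpace ℝ V] [FiniteDimensional ℝ V]
  [MeasurableSpace V] [BorelSpace V]

/-- Translating a function does not change the modulus of its inverse Fourier transform, and dilating
it by `r` dilates the inverse Fourier transform by `r⁻¹`, up to the Jacobian factor. -/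
theorem norm_fourierInv_comp_affine {E : Type*} [NormedAddCommGroup E] [NormedSpace ℂ E]
    (φ : V → E) (x : V) {r : ℝ} (hr : 0 < r) (y : V) :
    ‖𝓕⁻ (fun v ↦ φ (r⁻¹ • (v - x))) y‖ = r ^ finrank ℝ V * ‖𝓕⁻ φ (r • y)‖ := by
  have key : 𝓕⁻ (fun v ↦ φ (r⁻¹ • (v - x))) y
      = Real.fourierChar (inner ℝ x y) • (r ^ finrank ℝ V) • 𝓕⁻ φ (r • y) := by
    rw [Real.fourierInv_eq, Real.fourierInv_eq, ← integral_add_right_eq_self _ x]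
    have h := Measure.integral_comp_inv_smul (volume : Measure V)
      (fun w ↦ Real.fourierChar (inner ℝ w (r • y)) • φ w) r
    rw [abs_of_pos (pow_pos hr _)] at h
    rw [← h, Circle.smul_def, ← integral_smul]
    refine integral_congr_ae (ae_of_all _ fun v ↦ ?_)
    simp only [add_sub_cancel_right, inner_smul_left, inner_smul_right, inner_add_left]
    rw [← Circle.smul_def, smul_smul, ← AddChar.map_add_eq_mul]
    congr 2
    simp [hr.ne', add_comm]
  rw [key, Circle.norm_smul, norm_smul, Real.norm_of_nonneg (by positivity)]

/-- Scaling of the `L^p` norm with respect to Lebesgue measure under dilations. -/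
theorem eLpNorm_comp_smul {E : Type*} [NormedAddCommGroup E] (g : V → E) (hg : Continuous g)
    {p : ℝ} (hp : 0 < p) {r : ℝ} (hr : 0 < r) :
    eLpNorm (fun y ↦ g (r • y)) (ENNReal.ofReal p) volume
      = ENNReal.ofReal (r ^ (-(finrank ℝ V / p) : ℝ)) * eLpNorm g (ENNReal.ofReal p) volume := by
  have h := eLpNorm_map_measure (p := ENNReal.ofReal p) (μ := (volume : Measure V))
    (f := fun y : V ↦ r • y) (g := g) hg.aestronglyMeasurable (by fun_prop)
  rw [show (fun y ↦ g (r • y)) = g ∘ fun y : V ↦ r • y from rfl, ← h,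
    Measure.map_addHaar_smul _ hr.ne', eLpNorm_smul_measure_of_ne_top (by simp), smul_eq_mul,
    one_div, ENNReal.toReal_inv, ENNReal.toReal_ofReal hp.le, ENNReal.ofReal_rpow_of_pos (by positivity),
    abs_of_pos (by positivity)]
  congr 2
  rw [← Real.rpow_natCast, ← Real.rpow_neg hr.le, ← Real.rpow_mul hr.le]
  congr 1
  ring
end

/-- A measure admitting `(p,q)` restriction satisfies `μ(B(x,r)) ≤ K r^{dq/p'}` for all balls: test
the restriction inequality on the inverse Fourier transform of a smooth bump adapted to the ball. -/
theorem HasRestriction.exists_measure_closedBall_le {d : ℕ} {μ : Measure (Euc d)} {p q C : ℝ}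
    (hp : 0 < p) (hq : 0 < q) (h : HasRestriction μ p q C) :
    ∃ K : ℝ≥0∞, K ≠ ∞ ∧ ∀ (x : Euc d) (r : ℝ), 0 < r →
      μ (closedBall x r) ≤ K * ENNReal.ofReal r ^ ((d : ℝ) * q * (1 - p⁻¹)) := by
  let b : ContDiffBump (0 : Euc d) := ⟨1, 2, one_pos, one_lt_two⟩
  have hb : ContDiff ℝ (⊤ : ℕ∞) (fun v ↦ (b v : ℂ)) := Complex.ofRealCLM.contDiff.comp b.contDiff
  have hbc : HasCompactSupport (fun v ↦ (b v : ℂ)) :=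
    b.hasCompactSupport.comp_left Complex.ofReal_zero
  let φ : 𝓢(Euc d, ℂ) := hbc.toSchwartzMap hb
  let A := eLpNorm (𝓕⁻ φ : 𝓢(Euc d, ℂ)) (ENNReal.ofReal p) volume
  have hA : A ≠ ∞ := (SchwartzMap.eLpNorm_lt_top _ _ _).ne
  refine ⟨(ENNReal.ofReal C * A) ^ q, ?_, fun x r hr ↦ ?_⟩
  · exact ENNReal.rpow_ne_top_of_nonneg hq.le (ENNReal.mul_ne_top ENNReal.ofReal_ne_top hA)
  let e : Euc d ≃ₜ Euc d :=
    (Homeomorph.subRight x).trans (Homeomorph.smulOfNeZero r⁻¹ (by positivity))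
  have hgc : HasCompactSupport (fun v ↦ (b (r⁻¹ • (v - x)) : ℂ)) := hbc.comp_homeomorph e
  have hg : ContDiff ℝ (⊤ : ℕ∞) (fun v ↦ (b (r⁻¹ • (v - x)) : ℂ)) :=
    hb.comp (by fun_prop : ContDiff ℝ (⊤ : ℕ∞) fun v : Euc d ↦ r⁻¹ • (v - x))
  let g : 𝓢(Euc d, ℂ) := hgc.toSchwartzMap hg
  have hbound : eLpNorm (𝓕⁻ g : 𝓢(Euc d, ℂ)) (ENNReal.ofReal p) volume
      = ENNReal.ofReal (r ^ ((d : ℝ) * (1 - p⁻¹))) * A := by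
    have : eLpNorm (𝓕⁻ g : 𝓢(Euc d, ℂ)) (ENNReal.ofReal p) volume
        = eLpNorm ((r ^ d) • fun y ↦ (𝓕⁻ φ : 𝓢(Euc d, ℂ)) (r • y)) (ENNReal.ofReal p) volume := by
      refine eLpNorm_congr_norm_ae (ae_of_all _ fun y ↦ ?_)
      have := norm_fourierInv_comp_affine (φ : Euc d → ℂ) x hr y
      rw [SchwartzMap.fourierInv_coe, SchwartzMap.fourierInv_coe, Pi.smul_apply, norm_smul,
        Real.norm_of_nonneg (by positivity)]
      rw [finrank_euclideanSpace_fin] at this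
      exact this
    rw [this, eLpNorm_const_smul, eLpNorm_comp_smul _ (SchwartzMap.continuous _) hp hr,
      Real.enorm_of_nonneg (by positivity), ← mul_assoc, ← ENNReal.ofReal_mul (by positivity),
      finrank_euclideanSpace_fin, ← Real.rpow_natCast, ← Real.rpow_add hr]
    congr 3
    ring
  have hsub : closedBall x r ⊆ {v | 1 ≤ ‖g v‖ₑ} := by
    intro v hv
    have : b (r⁻¹ • (v - x)) = 1 := by
      apply b.one_of_mem_closedBall
      rw [mem_closedBall_zero_iff, norm_smul, norm_inv, Real.norm_of_nonneg hr.le]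
      rw [mem_closedBall, dist_eq_norm] at hv
      exact (inv_mul_le_one₀ hr).2 hv
    simp [g, this]
  have hf := h (𝓕⁻ g : 𝓢(Euc d, ℂ))
  rw [← SchwartzMap.fourier_coe, FourierTransform.fourier_fourierInv_eq, hbound] at hf
  calc μ (closedBall x r) ≤ μ {v | 1 ≤ ‖g v‖ₑ} := measure_mono hsub
    _ ≤ eLpNorm g (ENNReal.ofReal q) μ ^ q := by
      simpa [ENNReal.toReal_ofReal hq.le] using
        meas_ge_le_mul_pow_eLpNorm_enorm μ (p := ENNReal.ofReal q) (by simpa using hq) (by simp)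
          g.continuous.aestronglyMeasurable one_ne_zero (by simp)
    _ ≤ (ENNReal.ofReal C * (ENNReal.ofReal (r ^ ((d : ℝ) * (1 - p⁻¹))) * A)) ^ q := by gcongr
    _ = _ := by
      rw [mul_left_comm, ENNReal.mul_rpow_of_nonneg _ _ hq.le, mul_comm,
        ← ENNReal.ofReal_rpow_of_pos hr, ← ENNReal.rpow_mul]
      congr 2
      ring

/-- A measure with an upper Frostman bound `μ(B(x,r)) ≤ K r^s` is absolutely continuous with respect
to the `s`-dimensional Hausdorff measure. -/
theorem absolutelyContinuous_hausdorffMeasure_of_measure_closedBall_le {X : Type*} [MetricSpace X]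
    [MeasurableSpace X] [BorelSpace X] {μ : Measure X} {K : ℝ≥0∞} (hK : K ≠ ∞) {s : ℝ}
    (h : ∀ (x : X) (r : ℝ), 0 < r → μ (closedBall x r) ≤ K * ENNReal.ofReal r ^ s) :
    μ ≪ μH[s] := by
  have hK1 : K + 1 ≠ ∞ := by simpa using hK
  have hle : (K + 1)⁻¹ • μ ≤ μH[s] := by
    refine Measure.le_hausdorffMeasure s _ 1 one_pos fun S hS ↦ ?_
    rcases S.eq_empty_or_nonempty with rfl | ⟨x, hx⟩
    · simp
    have hfin : ediam S ≠ ∞ := (hS.trans_lt ENNReal.one_lt_top).ne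
    have hr : ∀ r : ℝ, diam S < r → μ S ≤ (K + 1) * ENNReal.ofReal r ^ s := by
      intro r hr
      refine (measure_mono fun y hy ↦ ?_).trans <|
        (h x r (diam_nonneg.trans_lt hr)).trans (by gcongr; exact le_self_add)
      exact (dist_le_diam_of_mem' hfin hy hx).trans hr.le
    have hlim : Tendsto (fun r : ℝ ↦ (K + 1) * ENNReal.ofReal r ^ s) (𝓝[>] diam S)
        (𝓝 ((K + 1) * ediam S ^ s)) := by
      rw [← ENNReal.ofReal_toReal hfin]
      refine ((ENNReal.continuous_const_mul hK1).comp (ENNReal.continuous_rpow_const.comp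
        ENNReal.continuous_ofReal)).tendsto _ |>.mono_left nhdsWithin_le_nhds
    have := ge_of_tendsto hlim (eventually_mem_nhdsWithin.mono hr)
    rw [Measure.smul_apply, smul_eq_mul, mul_comm, ← div_eq_mul_inv]
    exact ENNReal.div_le_of_le_mul' this
  refine Measure.AbsolutelyContinuous.trans ?_ hle.absolutelyContinuous
  exact Measure.absolutelyContinuous_smul (by simpa using hK)

/-- If a Radon measure `μ` admits `(p,q)` restriction, then `μ ≪ H^{dq/p'}`. -/
theorem restriction_absolutelyContinuous_hausdorff (d : ℕ) (p q C : ℝ) (hp : 1 < p) (hq : 1 ≤ q)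
    (μ : Measure (Euc d)) [IsLocallyFiniteMeasure μ] (h : HasRestriction μ p q C) :
    μ ≪ μH[(d : ℝ) * q / (p / (p - 1))] := by
  have hp0 : 0 < p := one_pos.trans hp
  have hq0 : 0 < q := one_pos.trans_le hq
  have hs : (d : ℝ) * q / (p / (p - 1)) = (d : ℝ) * q * (1 - p⁻¹) := by
    rw [div_div_eq_mul_div, mul_div_assoc, sub_div, div_self hp0.ne', one_div]
  obtain ⟨K, hK, hball⟩ := h.exists_measure_closedBall_le hp0 hq0
  rw [hs]
  exact absolutelyContinuous_hausdorffMeasure_of_measure_closedBall_le hK hball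

end
end

section
/- Let η = θ ⊗ H^k⌞V, where V is a k-dimensional linear subspace of ℝ^d with k ≥ 1, and θ a nonzero Radon measure on V^⊥. If η admits (p,q) Fourier restriction for some p,q ∈ [1,∞], then q = p'. -/
open MeasureTheory Metric Filter
open scoped FourierTransform ENNReal SchwartzMap

noncomputable section

/-- `(p,q)` Fourier restriction with extended-real exponents `p, q ∈ [1,∞]`. -/
def HasRestrictionE {d : ℕ} (μ : Measure (Euc d)) (p q : ℝ≥0∞) (C : ℝ) : Prop :=
  ∀ f : 𝓢(Euc d, ℂ),
    eLpNorm (𝓕 (f : Euc d → ℂ)) q μ ≤ ENNReal.ofReal C * eLpNorm (f : Euc d → ℂ) p volume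

/-- The product measure `θ ⊗ H^k⌞V` on `ℝ^d = V ⊕ V^⊥`, where `θ` is a measure on `V^⊥`. -/
def tensorWith {d : ℕ} (V : Submodule ℝ (Euc d)) (θ : Measure ↥Vᗮ) (k : ℕ) :
    Measure (Euc d) :=
  Measure.map (fun p : Euc d × Euc d => p.1 + p.2)
    ((Measure.map (Subtype.val : ↥Vᗮ → Euc d) θ).prod
      ((μH[(k : ℝ)] : Measure (Euc d)).restrict (V : Set (Euc d))))

/-- The Fourier transform of `g ∘ A`, where `B` is the transpose of `A⁻¹`. -/
theorem fourier_comp_linearEquiv {d : ℕ} (A : Euc d ≃ₗ[ℝ] Euc d) (B : Euc d → Euc d)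
    (hAB : ∀ x y, inner ℝ (A.symm x) y = inner ℝ x (B y)) (g : Euc d → ℂ) (ξ : Euc d) :
    𝓕 (fun x => g (A x)) ξ = |(LinearMap.det (A : Euc d →ₗ[ℝ] Euc d))⁻¹| • 𝓕 g (B ξ) := by
  have hdet : LinearMap.det (A : Euc d →ₗ[ℝ] Euc d) ≠ 0 := A.isUnit_det'.ne_zero
  have hmap := Measure.map_linearMap_addHaar_eq_smul_addHaar (volume : Measure (Euc d)) hdet
  have hA : MeasurableEmbedding A :=
    A.toContinuousLinearEquiv.toHomeomorph.measurableEmbedding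
  have key := hA.integral_map (μ := volume)
    (fun y => Real.fourierChar (-inner ℝ (A.symm y) ξ) • g y)
  rw [Real.fourier_eq, Real.fourier_eq]
  simp only [LinearEquiv.symm_apply_apply] at key
  rw [← key]
  change ∫ y, _ ∂(Measure.map (A : Euc d →ₗ[ℝ] Euc d) volume) = _
  rw [hmap, integral_smul_measure, ENNReal.toReal_ofReal (abs_nonneg _)]
  simp only [hAB]

/-- The linear map acting as `r` on `V` and as the identity on `Vᗮ`. -/
def scaleAlong {d : ℕ} (V : Submodule ℝ (Euc d)) (r : ℝ) (hr : r ≠ 0) : Euc d ≃ₗ[ℝ] Euc d :=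
  ((V.prodEquivOfIsCompl Vᗮ V.isCompl_orthogonal).symm ≪≫ₗ
    (LinearEquiv.smulOfNeZero ℝ V r hr).prodCongr (LinearEquiv.refl ℝ Vᗮ)) ≪≫ₗ
    V.prodEquivOfIsCompl Vᗮ V.isCompl_orthogonal

section scaleAlong

variable {d : ℕ} (V : Submodule ℝ (Euc d)) {r : ℝ} (hr : r ≠ 0)

theorem scaleAlong_add {v w : Euc d} (hv : v ∈ V) (hw : w ∈ Vᗮ) :
    scaleAlong V r hr (w + v) = w + r • v := by
  have h : w + v = V.prodEquivOfIsCompl Vᗮ V.isCompl_orthogonal (⟨v, hv⟩, ⟨w, hw⟩) := by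
    simp [add_comm]
  rw [h, scaleAlong]
  simp only [LinearEquiv.trans_apply, LinearEquiv.symm_apply_apply]
  simp [add_comm]

theorem scaleAlong_symm_add {v w : Euc d} (hv : v ∈ V) (hw : w ∈ Vᗮ) :
    (scaleAlong V r hr).symm (w + v) = w + r⁻¹ • v := by
  rw [LinearEquiv.symm_apply_eq, scaleAlong_add V hr (V.smul_mem _ hv) hw, smul_inv_smul₀ hr]

theorem det_scaleAlong :
    LinearMap.det (scaleAlong V r hr : Euc d →ₗ[ℝ] Euc d) = r ^ Module.finrank ℝ V := by
  have h : (scaleAlong V r hr : Euc d →ₗ[ℝ] Euc d) =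
      ((V.prodEquivOfIsCompl Vᗮ V.isCompl_orthogonal : V × Vᗮ →ₗ[ℝ] Euc d) ∘ₗ
        ((r • LinearMap.id : V →ₗ[ℝ] V).prodMap (LinearMap.id : Vᗮ →ₗ[ℝ] Vᗮ)) ∘ₗ
        (V.prodEquivOfIsCompl Vᗮ V.isCompl_orthogonal).symm) := rfl
  rw [h, LinearMap.det_conj, LinearMap.det_prodMap]
  simp

theorem inner_scaleAlong_symm (x y : Euc d) :
    inner ℝ ((scaleAlong V r hr).symm x) y = inner ℝ x ((scaleAlong V r hr).symm y) := by
  obtain ⟨a, ha, b, hb, rfl⟩ := V.exists_add_mem_mem_orthogonal x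
  obtain ⟨a', ha', b', hb', rfl⟩ := V.exists_add_mem_mem_orthogonal y
  rw [add_comm a, add_comm a', scaleAlong_symm_add V hr ha hb, scaleAlong_symm_add V hr ha' hb']
  simp [inner_add_left, inner_add_right, inner_smul_left, inner_smul_right,
    V.inner_right_of_mem_orthogonal ha hb', V.inner_left_of_mem_orthogonal ha' hb]

end scaleAlong


/-- `tensorWith` as the image of the product measure on `Vᗮ × V`. -/
theorem tensorWith_eq_map {d : ℕ} (V : Submodule ℝ (Euc d)) (θ : Measure ↥Vᗮ)
    [IsLocallyFiniteMeasure θ] :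
    tensorWith V θ (Module.finrank ℝ V) =
      Measure.map (fun p : Vᗮ × V => (p.1 : Euc d) + p.2)
        (θ.prod μH[(Module.finrank ℝ V : ℝ)]) := by
  have h : (μH[(Module.finrank ℝ V : ℝ)] : Measure (Euc d)).restrict (V : Set (Euc d)) =
      Measure.map (Subtype.val : V → Euc d) μH[(Module.finrank ℝ V : ℝ)] := by
    rw [isometry_subtype_coe.map_hausdorffMeasure (Or.inl (by positivity)), Subtype.range_coe]
  rw [tensorWith, h, Measure.map_prod_map _ _ measurable_subtype_coe measurable_subtype_coe,
    Measure.map_map (by fun_prop) (by fun_prop)]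
  rfl

theorem tensorWith_ne_zero {d : ℕ} (V : Submodule ℝ (Euc d)) (θ : Measure ↥Vᗮ)
    [IsLocallyFiniteMeasure θ] (hθ : θ ≠ 0) : tensorWith V θ (Module.finrank ℝ V) ≠ 0 := by
  rw [tensorWith_eq_map, Ne, Measure.map_eq_zero_iff (by fun_prop), ← Measure.measure_univ_eq_zero,
    ← Set.univ_prod_univ, Measure.prod_prod, mul_eq_zero, Measure.measure_univ_eq_zero,
    Measure.measure_univ_eq_zero, not_or]
  exact ⟨hθ, NeZero.ne _⟩

theorem map_scaleAlong_symm_tensorWith {d : ℕ} (V : Submodule ℝ (Euc d)) (θ : Measure ↥Vᗮ)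
    [IsLocallyFiniteMeasure θ] {r : ℝ} (hr : r ≠ 0) :
    Measure.map (scaleAlong V r hr).symm (tensorWith V θ (Module.finrank ℝ V)) =
      ENNReal.ofReal |r ^ Module.finrank ℝ V| • tensorWith V θ (Module.finrank ℝ V) := by
  have hm : Measurable (scaleAlong V r hr).symm :=
    (scaleAlong V r hr).symm.toContinuousLinearEquiv.continuous.measurable
  have hsmul := Measure.map_addHaar_smul (μH[(Module.finrank ℝ V : ℝ)] : Measure V)
    (inv_ne_zero hr)
  rw [inv_pow, inv_inv] at hsmul
  have hcomp : (scaleAlong V r hr).symm ∘ (fun p : Vᗮ × V => (p.1 : Euc d) + p.2) =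
      (fun p : Vᗮ × V => (p.1 : Euc d) + p.2) ∘ Prod.map id (r⁻¹ • ·) := by
    ext1 p
    simpa using scaleAlong_symm_add V hr p.2.2 p.1.2
  rw [tensorWith_eq_map, Measure.map_map hm (by fun_prop), hcomp,
    ← Measure.map_map (by fun_prop) (by fun_prop),
    ← Measure.map_prod_map _ _ measurable_id (by fun_prop), hsmul, Measure.map_id,
    Measure.prod_smul_right, Measure.map_smul]

/-- A nonzero measure has a Schwartz function whose Fourier transform is nonzero for it. -/
theorem exists_schwartz_eLpNorm_fourier_ne_zero {d : ℕ} {μ : Measure (Euc d)} (hμ : μ ≠ 0)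
    {q : ℝ≥0∞} (hq : q ≠ 0) : ∃ g : 𝓢(Euc d, ℂ), eLpNorm (𝓕 (g : Euc d → ℂ)) q μ ≠ 0 := by
  obtain ⟨n, hn⟩ : ∃ n : ℕ, μ (closedBall 0 n) ≠ 0 := by
    by_contra! hz
    apply hμ
    rw [← Measure.measure_univ_eq_zero, ← iUnion_closedBall_nat (0 : Euc d)]
    exact measure_iUnion_null hz
  let b : ContDiffBump (0 : Euc d) := ⟨n + 1, n + 2, by positivity, by linarith⟩
  have hsupp : HasCompactSupport (fun x => (b x : ℂ)) :=
    b.hasCompactSupport.comp_left (g := ((↑) : ℝ → ℂ)) Complex.ofReal_zero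
  have hsmooth : ContDiff ℝ (⊤ : ℕ∞) (fun x => (b x : ℂ)) :=
    Complex.ofRealCLM.contDiff.comp b.contDiff
  let φ : 𝓢(Euc d, ℂ) := hsupp.toSchwartzMap hsmooth
  refine ⟨𝓕⁻ φ, fun h0 => hn ?_⟩
  rw [← SchwartzMap.fourier_coe, FourierTransform.fourier_fourierInv_eq,
    eLpNorm_eq_zero_iff φ.continuous.aestronglyMeasurable hq] at h0
  refine measure_mono_null (fun x hx => ?_) (ae_iff.1 h0)
  change ¬ (b x : ℂ) = 0
  have hb : b x = 1 := b.one_of_mem_closedBall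
    (closedBall_subset_closedBall (show (n : ℝ) ≤ n + 1 by linarith) hx)
  simp [hb]

/-- A scaling inequality valid at all scales forces the exponents to balance. -/
theorem add_eq_one_of_scaling {a b : ℝ} {N K : ℝ≥0∞} (hN : N ≠ 0) (hK : K ≠ ∞)
    (h : ∀ t : ℝ, 0 < t → ENNReal.ofReal t⁻¹ * (ENNReal.ofReal t ^ a * N) ≤
      ENNReal.ofReal t⁻¹ ^ b * K) : a + b = 1 := by
  have hN' : N ≠ ∞ := by
    have h1 := h 1 one_pos
    simp only [inv_one, ENNReal.ofReal_one, ENNReal.one_rpow, one_mul] at h1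
    exact ne_top_of_le_ne_top hK h1
  have hNpos : 0 < N.toReal := ENNReal.toReal_pos hN hN'
  have hreal : ∀ t : ℝ, 0 < t → t ^ (a + b - 1) * N.toReal ≤ K.toReal := by
    intro t ht
    have h1 := h t ht
    rw [ENNReal.ofReal_rpow_of_pos ht, ENNReal.ofReal_rpow_of_pos (inv_pos.2 ht)] at h1
    have h2 := ENNReal.toReal_mono (ENNReal.mul_ne_top ENNReal.ofReal_ne_top hK) h1
    rw [ENNReal.toReal_mul, ENNReal.toReal_mul, ENNReal.toReal_mul,
      ENNReal.toReal_ofReal (by positivity), ENNReal.toReal_ofReal (by positivity),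
      ENNReal.toReal_ofReal (by positivity), Real.inv_rpow ht.le] at h2
    have h3 : t ^ (a + b - 1) * N.toReal = t ^ b * (t⁻¹ * (t ^ a * N.toReal)) := by
      rw [Real.rpow_sub ht, Real.rpow_add ht, Real.rpow_one]
      ring
    have htb : 0 < t ^ b := Real.rpow_pos_of_pos ht b
    calc t ^ (a + b - 1) * N.toReal = t ^ b * (t⁻¹ * (t ^ a * N.toReal)) := h3
      _ ≤ t ^ b * ((t ^ b)⁻¹ * K.toReal) := by gcongr
      _ = K.toReal := mul_inv_cancel_left₀ htb.ne' _
  by_contra hne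
  have hs : a + b - 1 ≠ 0 := sub_ne_zero.2 hne
  have hpos : 0 < K.toReal / N.toReal + 1 := by positivity
  have h1 := hreal ((K.toReal / N.toReal + 1) ^ (a + b - 1)⁻¹) (Real.rpow_pos_of_pos hpos _)
  rw [Real.rpow_inv_rpow hpos.le hs, add_mul, div_mul_cancel₀ _ hNpos.ne'] at h1
  linarith

/-- The restriction inequality applied to `g` rescaled along `V`. -/
theorem HasRestrictionE.scaling {d : ℕ} {V : Submodule ℝ (Euc d)} {θ : Measure ↥Vᗮ}
    [IsLocallyFiniteMeasure θ] {p q : ℝ≥0∞} {C : ℝ}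
    (h : HasRestrictionE (tensorWith V θ (Module.finrank ℝ V)) p q C) (g : 𝓢(Euc d, ℂ))
    {r : ℝ} (hr : 0 < r) :
    ENNReal.ofReal (r ^ Module.finrank ℝ V)⁻¹ *
        (ENNReal.ofReal (r ^ Module.finrank ℝ V) ^ (1 / q).toReal *
          eLpNorm (𝓕 (g : Euc d → ℂ)) q (tensorWith V θ (Module.finrank ℝ V))) ≤
      ENNReal.ofReal (r ^ Module.finrank ℝ V)⁻¹ ^ (1 / p).toReal *
        (ENNReal.ofReal C * eLpNorm g p volume) := by
  have hrk : 0 < r ^ Module.finrank ℝ V := by positivity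
  let A := scaleAlong V r hr.ne'
  have hdet : LinearMap.det (A : Euc d →ₗ[ℝ] Euc d) = r ^ Module.finrank ℝ V :=
    det_scaleAlong V hr.ne'
  have hA : MeasurableEmbedding A :=
    A.toContinuousLinearEquiv.toHomeomorph.measurableEmbedding
  have hAs : MeasurableEmbedding A.symm :=
    A.symm.toContinuousLinearEquiv.toHomeomorph.measurableEmbedding
  have hp : eLpNorm (fun x => g (A x)) p volume =
      ENNReal.ofReal (r ^ Module.finrank ℝ V)⁻¹ ^ (1 / p).toReal * eLpNorm g p volume := by
    have hmap := Measure.map_linearMap_addHaar_eq_smul_addHaar (volume : Measure (Euc d))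
      (f := (A : Euc d →ₗ[ℝ] Euc d)) (by rw [hdet]; exact hrk.ne')
    rw [hdet, abs_of_pos (inv_pos.2 hrk)] at hmap
    rw [← smul_eq_mul, ← eLpNorm_smul_measure_of_ne_zero (by simpa using hrk), ← hmap]
    exact (hA.eLpNorm_map_measure (g := (g : Euc d → ℂ))).symm
  have hq : eLpNorm (𝓕 (fun x => g (A x))) q (tensorWith V θ (Module.finrank ℝ V)) =
      ENNReal.ofReal (r ^ Module.finrank ℝ V)⁻¹ *
        (ENNReal.ofReal (r ^ Module.finrank ℝ V) ^ (1 / q).toReal *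
          eLpNorm (𝓕 (g : Euc d → ℂ)) q (tensorWith V θ (Module.finrank ℝ V))) := by
    have hF : 𝓕 (fun x => g (A x)) =
        (r ^ Module.finrank ℝ V)⁻¹ • (𝓕 (g : Euc d → ℂ) ∘ A.symm) := by
      ext ξ
      rw [fourier_comp_linearEquiv A A.symm (inner_scaleAlong_symm V hr.ne'), hdet,
        abs_of_pos (inv_pos.2 hrk)]
      rfl
    have hmap := map_scaleAlong_symm_tensorWith V θ hr.ne'
    rw [abs_of_pos hrk] at hmap
    rw [hF, eLpNorm_const_smul, Real.enorm_of_nonneg (inv_pos.2 hrk).le,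
      ← hAs.eLpNorm_map_measure, hmap, eLpNorm_smul_measure_of_ne_zero (by simpa using hrk),
      smul_eq_mul]
  have h1 := h (SchwartzMap.compCLMOfContinuousLinearEquiv ℂ A.toContinuousLinearEquiv g)
  rw [← hq]
  refine (h1.trans_eq ?_)
  rw [mul_left_comm, ← hp]
  rfl

/-- If `η = θ ⊗ H^k⌞V` with `V` a `k`-dimensional subspace, `k ≥ 1`, and `θ` a nonzero
Radon measure on `V^⊥`, and `η` admits `(p,q)` restriction for some `p, q ∈ [1,∞]`,
then `q = p'`, i.e. `1/p + 1/q = 1`. -/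
theorem tensor_restriction_forces_conjugate (d k : ℕ) (hk : 1 ≤ k)
    (V : Submodule ℝ (Euc d)) (hV : Module.finrank ℝ V = k)
    (θ : Measure ↥Vᗮ) [IsLocallyFiniteMeasure θ] (hθ : θ ≠ 0)
    (p q : ℝ≥0∞) (hp : 1 ≤ p) (hq : 1 ≤ q)
    (h : ∃ C : ℝ, HasRestrictionE (tensorWith V θ k) p q C) :
    1 / p + 1 / q = 1 := by
  obtain ⟨C, hC⟩ := h
  subst hV
  have hq0 : q ≠ 0 := (one_pos.trans_le hq).ne'
  have hp0 : p ≠ 0 := (one_pos.trans_le hp).ne'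
  obtain ⟨g, hg⟩ := exists_schwartz_eLpNorm_fourier_ne_zero (tensorWith_ne_zero V θ hθ) hq0
  have hsum : (1 / q).toReal + (1 / p).toReal = 1 := by
    refine add_eq_one_of_scaling (K := ENNReal.ofReal C * eLpNorm g p volume) hg
      (ENNReal.mul_ne_top ENNReal.ofReal_ne_top (g.eLpNorm_lt_top p volume).ne) fun t ht => ?_
    have h1 := hC.scaling g (r := t ^ (Module.finrank ℝ V : ℝ)⁻¹) (Real.rpow_pos_of_pos ht _)
    rwa [Real.rpow_inv_natCast_pow ht.le (Nat.one_le_iff_ne_zero.1 hk)] at h1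
  have hq' : 1 / q ≠ ∞ := by simpa using hq0
  have hp' : 1 / p ≠ ∞ := by simpa using hp0
  rw [add_comm, ← ENNReal.toReal_eq_one_iff, ENNReal.toReal_add hq' hp', hsum]

end
end

section
/- Let μ be a Radon measure on ℝ^d satisfying 0 < Θ^{*s}(μ,x) < ∞ for μ-a.e. x, and suppose the endpoint restriction estimate R_μ(p → q) holds with q = (s/d)p' for some p > 1. Then either q = p' (equivalently s = d) and μ is absolutely continuous with respect to Lebesgue measure, or μ is supported on a 1-purely unrectifiable set. -/
open MeasureTheory Metric Filter
open scoped FourierTransform ENNReal NNReal SchwartzMap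

noncomputable section

/-- The upper `s`-density of `μ` at `x`. -/
def upperDensity {d : ℕ} (μ : Measure (Euc d)) (s : ℝ) (x : Euc d) : ℝ≥0∞ :=
  limsup (fun r : ℝ => μ (closedBall x r) / ENNReal.ofReal (r ^ s)) (nhdsWithin 0 (Set.Ioi 0))

/-- `γ` is a graph over the `i`-th coordinate axis whose other coordinates are `2`-Lipschitz. -/
def IsConeCurve {d : ℕ} (i : Fin d) (γ : ℝ → Euc d) : Prop :=
  (∀ t, γ t i = t) ∧ ∀ k s t, |γ t k - γ s k| ≤ 2 * |t - s|

lemma IsConeCurve.lipschitz {d : ℕ} {i : Fin d} {γ : ℝ → Euc d} (h : IsConeCurve i γ) :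
    ∃ K : ℝ≥0, LipschitzWith K γ := by
  have h1 : LipschitzWith 2 (fun t => (WithLp.ofLp (γ t) : Fin d → ℝ)) := by
    refine LipschitzWith.of_dist_le_mul fun s t => ?_
    refine (dist_pi_le_iff (by positivity)).2 fun k => ?_
    rw [Real.dist_eq, Real.dist_eq]
    simpa using h.2 k t s
  exact ⟨_, (PiLp.lipschitzWith_toLp 2 (fun _ : Fin d => ℝ)).comp h1⟩

lemma IsConeCurve.hausdorffMeasure_inter_range {d : ℕ} {i : Fin d} {γ : ℝ → Euc d}
    (h : IsConeCurve i γ) {S : Set (Euc d)} (hS : volume {t | γ t ∈ S} = 0) :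
    μH[(1 : ℝ)] (S ∩ Set.range γ) = 0 := by
  obtain ⟨K, hK⟩ := h.lipschitz
  have h1 : S ∩ Set.range γ ⊆ γ '' {t | γ t ∈ S} := by
    rintro _ ⟨hx, t, rfl⟩
    exact ⟨t, hx, rfl⟩
  refine measure_mono_null h1 (le_antisymm ?_ zero_le)
  refine (hK.hausdorffMeasure_image_le zero_le_one _).trans ?_
  rw [hausdorffMeasure_real, hS, mul_zero]

lemma exists_isConeCurve_of_cone_set {d : ℕ} (i : Fin d) (G : Set (Euc d))
    (hG : ∀ x ∈ G, ∀ y ∈ G, ∀ k, |x k - y k| ≤ 2 * |x i - y i|) :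
    ∃ γ : ℝ → Euc d, IsConeCurve i γ ∧ G ⊆ Set.range γ := by
  classical
  have hx : ∀ t ∈ (fun x : Euc d => x i) '' G, ∃ x ∈ G, x i = t := fun t ht => ht
  choose! X hXG hXi using hx
  have h1 : ∀ k : Fin d, ∃ g : ℝ → ℝ, LipschitzWith 2 g ∧
      Set.EqOn (fun t => X t k) g ((fun x : Euc d => x i) '' G) := by
    intro k
    refine LipschitzOnWith.extend_real (LipschitzOnWith.of_dist_le_mul fun s hs t ht => ?_)
    rw [Real.dist_eq, Real.dist_eq]
    have := hG _ (hXG s hs) _ (hXG t ht) k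
    rw [hXi s hs, hXi t ht] at this
    simpa using this
  choose g hgL hg using h1
  refine ⟨fun t => WithLp.toLp 2 (fun k => if k = i then t else g k t), ⟨fun t => by simp, ?_⟩, ?_⟩
  · intro k s t
    by_cases hk : k = i
    · simp only [hk, if_true]
      linarith [abs_nonneg (t - s)]
    · have := (hgL k).dist_le_mul t s
      simpa [hk, Real.dist_eq] using this
  · intro x hx
    refine ⟨x i, ?_⟩
    ext k
    have hmem : x i ∈ (fun x : Euc d => x i) '' G := ⟨x, hx, rfl⟩
    have hXx : ∀ k, X (x i) k = x k := by
      intro k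
      have := hG _ (hXG _ hmem) _ hx k
      rw [hXi _ hmem] at this
      simp only [sub_self, abs_zero, mul_zero] at this
      exact sub_eq_zero.1 (abs_nonpos_iff.1 this)
    by_cases hk : k = i
    · simp [hk]
    · have := hg k hmem
      simp only at this
      simp [hk, ← this, hXx]

lemma abs_sub_le_of_approximatesLinearOn {d : ℕ} {φ : ℝ → Euc d} {A : ℝ →L[ℝ] Euc d} {s : Set ℝ}
    {i : Fin d} (hA : ∀ k, |A 1 k| ≤ |A 1 i|) (h : ∀ x ∈ s, ∀ y ∈ s,
      ‖φ x - φ y - A (x - y)‖ ≤ |A 1 i| / 4 * |x - y|) (x : ℝ) (hx : x ∈ s) (y : ℝ) (hy : y ∈ s)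
    (k : Fin d) : |φ x k - φ y k| ≤ 2 * |φ x i - φ y i| := by
  have h1 : ∀ j, |φ x j - φ y j - (x - y) * A 1 j| ≤ |A 1 i| / 4 * |x - y| := by
    intro j
    have h2 : A (x - y) = (x - y) • A 1 := by rw [← map_smul]; simp
    have h3 := (PiLp.norm_apply_le (φ x - φ y - A (x - y)) j).trans (h x hx y hy)
    simpa [h2] using h3
  have hi := h1 i
  have hk := h1 k
  have e1 : |(x - y) * A 1 i| = |A 1 i| * |x - y| := by rw [abs_mul, mul_comm]
  have e2 : |(x - y) * A 1 k| ≤ |A 1 i| * |x - y| := by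
    rw [abs_mul, mul_comm]
    exact mul_le_mul_of_nonneg_right (hA k) (abs_nonneg _)
  have t1 := abs_add_le (φ x k - φ y k - (x - y) * A 1 k) ((x - y) * A 1 k)
  rw [sub_add_cancel] at t1
  have t2 := abs_sub_abs_le_abs_sub ((x - y) * A 1 i) (φ x i - φ y i)
  rw [abs_sub_comm ((x - y) * A 1 i) (φ x i - φ y i)] at t2
  have : 0 ≤ |A 1 i| * |x - y| := by positivity
  linarith

/-- A set whose preimage under every cone curve is null meets every Lipschitz curve in a set of
zero length. -/
lemma hausdorffMeasure_inter_range_eq_zero {d : ℕ} {S : Set (Euc d)}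
    (hS : ∀ i γ, IsConeCurve i γ → volume {t | γ t ∈ S} = 0)
    {φ : ℝ → Euc d} {K : ℝ≥0} (hφ : LipschitzWith K φ) :
    μH[(1 : ℝ)] (S ∩ Set.range φ) = 0 := by
  classical
  set N : Set ℝ := {t | ¬ DifferentiableAt ℝ φ t} with hN
  have hN0 : volume N = 0 := by
    have := hφ.ae_differentiableAt (μ := volume)
    exact this
  have hNim : μH[(1 : ℝ)] (φ '' N) = 0 := by
    refine le_antisymm ((hφ.hausdorffMeasure_image_le zero_le_one _).trans ?_) zero_le
    rw [hausdorffMeasure_real, hN0, mul_zero]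
  have main : ∀ m : ℕ, μH[(1 : ℝ)] (S ∩ φ '' (Nᶜ ∩ Set.Icc (-m : ℝ) m)) = 0 := by
    intro m
    set s := Nᶜ ∩ Set.Icc (-m : ℝ) m with hs
    have hsvol : volume s ≠ ∞ :=
      (lt_of_le_of_lt (measure_mono Set.inter_subset_right) (by simp)).ne
    refine le_antisymm (ENNReal.le_of_forall_pos_le_add fun ε hε _ => ?_) zero_le
    rw [zero_add]
    obtain ⟨δ, hδ, hδε⟩ : ∃ δ : ℝ≥0, 0 < δ ∧ δ * volume s ≤ ε := by
      lift volume s to ℝ≥0 using hsvol with V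
      refine ⟨ε / (V + 1), by positivity, ?_⟩
      rw [← ENNReal.coe_mul, ENNReal.coe_le_coe, div_mul_eq_mul_div]
      exact div_le_of_le_mul₀ (by positivity) (by positivity)
        (mul_le_mul_of_nonneg_left (by simp) (by positivity))
    have hmax : ∀ A : ℝ →L[ℝ] Euc d, A ≠ 0 → ∃ i, A 1 i ≠ 0 ∧ ∀ k, |A 1 k| ≤ |A 1 i| := by
      intro A hA
      have h1 : A 1 ≠ 0 := by
        intro h0
        apply hA
        ext1
        simpa using h0
      have h2 : ∃ j, A 1 j ≠ 0 := by
        by_contra! hcon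
        exact h1 (by ext j; simpa using hcon j)
      obtain ⟨j, hj⟩ := h2
      have : Nonempty (Fin d) := ⟨j⟩
      obtain ⟨i, hi⟩ := Finite.exists_max (fun k => |A 1 k|)
      exact ⟨i, abs_pos.1 (lt_of_lt_of_le (abs_pos.2 hj) (hi j)), hi⟩
    let r : (ℝ →L[ℝ] Euc d) → ℝ≥0 := fun A => if A = 0 then δ else ‖(WithLp.ofLp (A 1) : Fin d → ℝ)‖₊ / 4
    have hr : ∀ A, r A ≠ 0 := by
      intro A
      by_cases hA : A = 0
      · simp [r, hA, hδ.ne']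
      · obtain ⟨i, hi, -⟩ := hmax A hA
        have : (WithLp.ofLp (A 1) : Fin d → ℝ) ≠ 0 := fun h0 => hi (by rw [h0]; rfl)
        simpa [r, hA] using this
    obtain ⟨t, A, hdisj, hmeas, hcov, happ, -⟩ :=
      exists_partition_approximatesLinearOn_of_hasFDerivWithinAt φ s (fun x => fderiv ℝ φ x)
        (fun x hx => (not_not.1 hx.1).hasFDerivAt.hasFDerivWithinAt) r hr
    have piece : ∀ n, μH[(1 : ℝ)] (S ∩ φ '' (s ∩ t n)) ≤ δ * volume (s ∩ t n) := by
      intro n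
      by_cases hA : A n = 0
      · have hL : LipschitzOnWith δ φ (s ∩ t n) := by
          refine LipschitzOnWith.of_dist_le_mul fun x hx y hy => ?_
          have := happ n x hx y hy
          simpa [r, hA, dist_eq_norm] using this
        refine (measure_mono Set.inter_subset_right).trans
          ((hL.hausdorffMeasure_image_le zero_le_one).trans ?_)
        rw [hausdorffMeasure_real, ENNReal.rpow_one]
      · obtain ⟨i, -, hi⟩ := hmax _ hA
        have hnorm : ‖(WithLp.ofLp (A n 1) : Fin d → ℝ)‖ ≤ |A n 1 i| :=
          (pi_norm_le_iff_of_nonneg (abs_nonneg _)).2 hi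
        obtain ⟨γ, hγ, hsub⟩ := exists_isConeCurve_of_cone_set i (φ '' (s ∩ t n)) (by
          rintro _ ⟨x, hx, rfl⟩ _ ⟨y, hy, rfl⟩ k
          refine abs_sub_le_of_approximatesLinearOn hi (fun x hx y hy => ?_) x hx y hy k
          refine (happ n x hx y hy).trans ?_
          simp only [r, hA, if_false, NNReal.coe_div, coe_nnnorm, NNReal.coe_ofNat]
          rw [Real.norm_eq_abs]
          gcongr)
        have h0 := hγ.hausdorffMeasure_inter_range (hS _ γ hγ)
        rw [measure_mono_null (Set.inter_subset_inter_right S hsub) h0]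
        exact zero_le
    calc μH[(1 : ℝ)] (S ∩ φ '' s)
        ≤ μH[(1 : ℝ)] (⋃ n, S ∩ φ '' (s ∩ t n)) := by
          refine measure_mono ?_
          rintro _ ⟨hx, u, hu, rfl⟩
          obtain ⟨n, hn⟩ := Set.mem_iUnion.1 (hcov hu)
          exact Set.mem_iUnion.2 ⟨n, hx, u, ⟨hu, hn⟩, rfl⟩
      _ ≤ ∑' n, μH[(1 : ℝ)] (S ∩ φ '' (s ∩ t n)) := measure_iUnion_le _
      _ ≤ ∑' n, δ * volume (s ∩ t n) := ENNReal.tsum_le_tsum piece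
      _ = δ * ∑' n, volume.restrict s (t n) := by
          rw [ENNReal.tsum_mul_left]
          congr 2
          ext n
          rw [Measure.restrict_apply (hmeas n), Set.inter_comm]
      _ = δ * volume.restrict s (⋃ n, t n) := by
          rw [measure_iUnion hdisj hmeas]
      _ ≤ δ * volume s :=
          mul_le_mul_right ((measure_mono (Set.subset_univ _)).trans_eq
            (Measure.restrict_apply_univ s)) _
      _ ≤ ε := hδε
  refine measure_mono_null (t := φ '' N ∪ ⋃ m : ℕ, S ∩ φ '' (Nᶜ ∩ Set.Icc (-m : ℝ) m)) ?_
    (measure_union_null hNim (measure_iUnion_null main))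
  rintro _ ⟨hx, u, rfl⟩
  by_cases hu : u ∈ N
  · exact Or.inl ⟨u, hu, rfl⟩
  · refine Or.inr ?_
    obtain ⟨m, hm⟩ := exists_nat_ge |u|
    exact Set.mem_iUnion.2 ⟨m, hx, u, ⟨hu, abs_le.1 hm⟩, rfl⟩

/-- The cone of vectors pointing along the `i`-th axis with slopes at most `2`. -/
def axisCone {d : ℕ} (i : Fin d) : Set (Euc d) := {v | ∀ k, |v k| ≤ 2 * v i}

lemma axisCone.nonneg {d : ℕ} {i : Fin d} {v : Euc d} (hv : v ∈ axisCone i) : 0 ≤ v i := by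
  have := (abs_nonneg _).trans (hv i)
  linarith

/-- `u` is a `C¹` function which grows along `axisCone i` at least at rate `h ≥ 0`. -/
structure IsWidth {d : ℕ} (i : Fin d) (u h : Euc d → ℝ) : Prop where
  contDiff : ContDiff ℝ 1 u
  continuous : Continuous h
  nonneg : ∀ x, 0 ≤ h x
  le_fderiv : ∀ x, ∀ v ∈ axisCone i, h x * v i ≤ fderiv ℝ u x v

lemma IsWidth.integral_le {d : ℕ} {i : Fin d} {u h : Euc d → ℝ} (hu : IsWidth i u h)
    {γ : ℝ → Euc d} (hγ : IsConeCurve i γ) {a b : ℝ} (hab : a ≤ b) :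
    ∫ t in a..b, h (γ t) ≤ u (γ b) - u (γ a) := by
  obtain ⟨K, hK⟩ := hγ.lipschitz
  have hcont : Continuous fun t => h (γ t) := hu.continuous.comp hK.continuous
  have key := image_le_of_liminf_slope_right_le_deriv_boundary
    (f := fun t => - u (γ t)) (a := a) (b := b)
    (B := fun t => - (∫ τ in a..t, h (γ τ)) - u (γ a)) (B' := fun t => - h (γ t))
    (hu.contDiff.continuous.comp hK.continuous).neg.continuousOn (by simp)
    ((intervalIntegral.continuous_primitive
      (fun a b => hcont.intervalIntegrable a b) a).neg.sub continuous_const).continuousOn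
    (fun x _ => by
      have := (hcont.integral_hasStrictDerivAt a x).hasDerivAt
      exact (this.neg.sub_const _).hasDerivWithinAt)
    (fun x _ r hr => by
      have hd : HasFDerivAt u (fderiv ℝ u (γ x)) (γ x) :=
        (hu.contDiff.differentiable one_ne_zero).differentiableAt.hasFDerivAt
      have ho := hd.isLittleO.comp_tendsto (hK.continuous.tendsto x)
      have hO : (fun z => γ z - γ x) =O[nhds x] fun z => z - x := by
        refine Asymptotics.IsBigO.of_bound K (Eventually.of_forall fun z => ?_)
        simpa [dist_eq_norm] using hK.dist_le_mul z x
      have ho' := (ho.trans_isBigO hO).def (c := (r + h (γ x)) / 2) (by linarith)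
      refine Eventually.frequently ?_
      filter_upwards [nhdsWithin_le_nhds ho', self_mem_nhdsWithin] with z hz hxz
      have hxz' : 0 < z - x := sub_pos.2 hxz
      have hcone : γ z - γ x ∈ axisCone i := by
        intro k
        have := hγ.2 k x z
        rw [abs_of_pos hxz'] at this
        simpa [hγ.1] using this
      have h1 := hu.le_fderiv (γ x) _ hcone
      have h2 : (γ z - γ x) i = z - x := by simp [hγ.1]
      rw [h2] at h1
      simp only [Function.comp_apply, Real.norm_eq_abs, abs_of_pos hxz'] at hz
      have h3 := (abs_le.1 hz).1
      rw [slope_def_field, div_lt_iff₀ hxz']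
      nlinarith)
  have := key (Set.right_mem_Icc.2 hab)
  linarith

lemma IsWidth.volume_le {d : ℕ} {i : Fin d} {u h : Euc d → ℝ} (hu : IsWidth i u h)
    {α β : ℝ} (hα : ∀ x, u x ≤ α) (hβ : ∀ x, -u x ≤ β)
    {γ : ℝ → Euc d} (hγ : IsConeCurve i γ) {a b : ℝ} (hab : a ≤ b) :
    volume ({t | 1 / 2 < h (γ t)} ∩ Set.Ioc a b) ≤ ENNReal.ofReal (2 * (α + β)) := by
  obtain ⟨K, hK⟩ := hγ.lipschitz
  have hcont : Continuous fun t => h (γ t) := hu.continuous.comp hK.continuous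
  have h1 : ∫ t in a..b, h (γ t) ≤ α + β := by
    linarith [hu.integral_le hγ hab, hα (γ b), hβ (γ a)]
  have h2 := mul_meas_ge_le_lintegral (μ := volume.restrict (Set.Ioc a b))
    (f := fun t => ENNReal.ofReal (h (γ t))) hcont.measurable.ennreal_ofReal (ENNReal.ofReal (1 / 2))
  rw [← ofReal_integral_eq_lintegral_ofReal
    ((hcont.integrableOn_Icc (a := a) (b := b)).mono_set Set.Ioc_subset_Icc_self)
    (Eventually.of_forall fun t => hu.nonneg _), ← intervalIntegral.integral_of_le hab] at h2
  have hm : MeasurableSet {t | ENNReal.ofReal (1 / 2) ≤ ENNReal.ofReal (h (γ t))} :=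
    measurableSet_le measurable_const hcont.measurable.ennreal_ofReal
  rw [Measure.restrict_apply hm] at h2
  calc volume ({t | 1 / 2 < h (γ t)} ∩ Set.Ioc a b)
      ≤ volume ({t | ENNReal.ofReal (1 / 2) ≤ ENNReal.ofReal (h (γ t))} ∩ Set.Ioc a b) :=
        measure_mono (Set.inter_subset_inter_left _ fun t ht =>
          ENNReal.ofReal_le_ofReal (le_of_lt ht))
    _ = ENNReal.ofReal 2 * (ENNReal.ofReal (1 / 2) *
          volume ({t | ENNReal.ofReal (1 / 2) ≤ ENNReal.ofReal (h (γ t))} ∩ Set.Ioc a b)) := by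
        rw [← mul_assoc, ← ENNReal.ofReal_mul (by norm_num)]
        norm_num
    _ ≤ ENNReal.ofReal 2 * ENNReal.ofReal (α + β) := by
        gcongr
        exact h2.trans (ENNReal.ofReal_le_ofReal h1)
    _ = _ := by rw [← ENNReal.ofReal_mul (by norm_num)]

lemma integrable_max_sub {X : Type*} [TopologicalSpace X] [MeasurableSpace X]
    [OpensMeasurableSpace X] {μ : Measure X} [IsFiniteMeasure μ] {c : ℝ} (hc : 0 ≤ c) {h : X → ℝ}
    (hcont : Continuous h) (hn : ∀ x, 0 ≤ h x) : Integrable (fun x => max (c - h x) 0) μ := by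
  refine Integrable.of_bound (C := c) (by fun_prop) (Eventually.of_forall fun x => ?_)
  rw [Real.norm_eq_abs, abs_of_nonneg (le_max_right _ _)]
  exact max_le (by linarith [hn x]) hc

lemma measure_le_of_integral_max {X : Type*} [TopologicalSpace X] [MeasurableSpace X]
    [OpensMeasurableSpace X] {μ : Measure X} [IsFiniteMeasure μ] {h : X → ℝ}
    (hcont : Continuous h) (hn : ∀ x, 0 ≤ h x) {ε : ℝ} (hε : ∫ x, max (1 - h x) 0 ∂μ ≤ ε) :
    μ {x | h x ≤ 1 / 2} ≤ ENNReal.ofReal (2 * ε) := by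
  have h2 := mul_meas_ge_le_integral_of_nonneg (μ := μ) (f := fun x => max (1 - h x) 0)
    (Eventually.of_forall fun x => le_max_right _ _)
    (integrable_max_sub zero_le_one hcont hn) (1 / 2)
  rw [ENNReal.le_ofReal_iff_toReal_le (measure_ne_top _ _)
    (by
      have : 0 ≤ ∫ x, max (1 - h x) 0 ∂μ := integral_nonneg fun x => le_max_right _ _
      linarith)]
  have h3 : μ.real {x | h x ≤ 1 / 2} ≤ μ.real {x | 1 / 2 ≤ max (1 - h x) 0} :=
    measureReal_mono (fun x (hx : h x ≤ 1 / 2) => (show (1 / 2 : ℝ) ≤ 1 - h x by linarith).trans (le_max_left _ _))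
  change μ.real _ ≤ _
  linarith

/-- If widths with arbitrarily small oscillation have rate close to `1` on most of `μ`, then `μ`
is carried by a set that is null along every cone curve. -/
lemma exists_null_along_cone_curves {d : ℕ} (i : Fin d) (μ : Measure (Euc d)) [IsFiniteMeasure μ]
    (H : ∀ ε > 0, ∃ u h, ∃ α β : ℝ, IsWidth i u h ∧ (∀ x, u x ≤ α) ∧ (∀ x, -u x ≤ β) ∧
      α + β ≤ ε ∧ ∫ x, max (1 - h x) 0 ∂μ ≤ ε) :
    ∃ S : Set (Euc d), μ Sᶜ = 0 ∧ ∀ γ, IsConeCurve i γ → volume {t | γ t ∈ S} = 0 := by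
  have hpos : ∀ k : ℕ, (0 : ℝ) < (1 / 2) ^ k := fun k => by positivity
  choose u h α β hu hα hβ hαβ hbound using fun k : ℕ => H _ (hpos k)
  refine ⟨{x | ∀ᶠ k in atTop, 1 / 2 < h k x}, ?_, fun γ hγ => ?_⟩
  · have : {x | ∀ᶠ k in atTop, 1 / 2 < h k x}ᶜ = {x | ∃ᶠ k in atTop, h k x ≤ 1 / 2} := by
      ext x
      simp [Filter.Frequently]
    rw [this]
    refine measure_setOfPred_frequently_eq_zero (p := fun k x => h k x ≤ 1 / 2) ?_
    refine ne_top_of_le_ne_top ?_ (ENNReal.tsum_le_tsum fun k =>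
      measure_le_of_integral_max (hu k).continuous (hu k).nonneg (hbound k))
    rw [← ENNReal.ofReal_tsum_of_nonneg (fun k => by positivity)
      ((summable_geometric_of_lt_one (by norm_num) (by norm_num)).mul_left 2)]
    exact ENNReal.ofReal_ne_top
  · have hlim : Tendsto (fun k : ℕ => ENNReal.ofReal (2 * (1 / 2) ^ k)) atTop (nhds 0) := by
      have := (tendsto_pow_atTop_nhds_zero_of_lt_one (r := (1 / 2 : ℝ)) (by norm_num)
        (by norm_num)).const_mul 2
      simpa using ENNReal.tendsto_ofReal this
    have hm : ∀ m n : ℕ, volume ({t | ∀ k ≥ m, 1 / 2 < h k (γ t)} ∩ Set.Ioc (-n : ℝ) n) = 0 := by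
      intro m n
      refine le_antisymm (ge_of_tendsto hlim ?_) zero_le
      filter_upwards [eventually_ge_atTop m] with k hk
      have hn : (-n : ℝ) ≤ n := by linarith [n.cast_nonneg (α := ℝ)]
      calc volume ({t | ∀ k ≥ m, 1 / 2 < h k (γ t)} ∩ Set.Ioc (-n : ℝ) n)
          ≤ volume ({t | 1 / 2 < h k (γ t)} ∩ Set.Ioc (-n : ℝ) n) :=
            measure_mono fun t ht => ⟨ht.1 k hk, ht.2⟩
        _ ≤ ENNReal.ofReal (2 * (α k + β k)) := (hu k).volume_le (hα k) (hβ k) hγ hn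
        _ ≤ _ := ENNReal.ofReal_le_ofReal (mul_le_mul_of_nonneg_left (hαβ k) zero_le_two)
    refine measure_mono_null (t := ⋃ m : ℕ, ⋃ n : ℕ,
      {t | ∀ k ≥ m, 1 / 2 < h k (γ t)} ∩ Set.Ioc (-n : ℝ) n) ?_
      (measure_iUnion_null fun m => measure_iUnion_null fun n => hm m n)
    intro t ht
    obtain ⟨m, hm⟩ := eventually_atTop.1 (show ∀ᶠ k in atTop, 1 / 2 < h k (γ t) from ht)
    obtain ⟨n, hn⟩ := exists_nat_gt |t|
    exact Set.mem_iUnion₂.2 ⟨m, n, hm, (abs_lt.1 hn).1, (abs_lt.1 hn).2.le⟩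

open scoped CompactlySupported

lemma exists_measure_of_nonneg_functional {d : ℕ} (L : C_c(Euc d, ℝ) →ₗ[ℝ] ℝ)
    (hL : ∀ φ, (∀ x, 0 ≤ φ x) → 0 ≤ L φ) :
    ∃ P : Measure (Euc d), IsLocallyFiniteMeasure P ∧ ∀ φ : C_c(Euc d, ℝ), ∫ x, φ x ∂P = L φ := by
  let Λ : C_c(Euc d, ℝ) →ₚ[ℝ] ℝ := PositiveLinearMap.mk₀ L (fun φ hφ => hL φ fun x => hφ x)
  exact ⟨RealRMK.rieszMeasure Λ, inferInstance, fun φ => RealRMK.integral_rieszMeasure Λ φ⟩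

/-- Test data: a compactly supported field together with two compactly supported functions. -/
abbrev TestData (d : ℕ) := (Fin d → C_c(Euc d, ℝ)) × C_c(Euc d, ℝ) × C_c(Euc d, ℝ)

/-- The cone of test data dominated by a function `u` growing along `axisCone i`. -/
def widthCone {d : ℕ} (i : Fin d) (μ : Measure (Euc d)) (ε : ℝ) : Set (TestData d × ℝ) :=
  {p | ∃ u h : Euc d → ℝ, ∃ α β c : ℝ, ContDiff ℝ 1 u ∧ Continuous h ∧ (∀ x, 0 ≤ h x) ∧ 0 ≤ c ∧
    (∀ x, u x + p.1.2.1 x ≤ α) ∧ (∀ x, p.1.2.2 x - u x ≤ β) ∧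
    (∀ x, ∀ v ∈ axisCone i, h x * v i + ∑ k, p.1.1 k x * v k ≤ fderiv ℝ u x v) ∧
    ∫ x, max (c - h x) 0 ∂μ + (α + β) - c * ε ≤ p.2}

lemma widthCone_add {d : ℕ} {i : Fin d} {μ : Measure (Euc d)} [IsFiniteMeasure μ] {ε : ℝ}
    {p q : TestData d × ℝ} (hp : p ∈ widthCone i μ ε) (hq : q ∈ widthCone i μ ε) :
    p + q ∈ widthCone i μ ε := by
  obtain ⟨u, h, α, β, c, hu, hc, hn, hc0, hα, hβ, hF, ht⟩ := hp
  obtain ⟨u', h', α', β', c', hu', hc', hn', hc0', hα', hβ', hF', ht'⟩ := hq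
  refine ⟨fun x => u x + u' x, fun x => h x + h' x, α + α', β + β', c + c', hu.add hu',
    hc.add hc', fun x => add_nonneg (hn x) (hn' x), add_nonneg hc0 hc0', fun x => ?_, fun x => ?_,
    fun x v hv => ?_, ?_⟩
  · have := hα x; have := hα' x
    simp only [Prod.fst_add, Prod.snd_add, CompactlySupportedContinuousMap.coe_add, Pi.add_apply]
    linarith
  · have := hβ x; have := hβ' x
    simp only [Prod.fst_add, Prod.snd_add, CompactlySupportedContinuousMap.coe_add, Pi.add_apply]
    linarith
  · have h1 := hF x v hv
    have h2 := hF' x v hv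
    rw [fderiv_fun_add (hu.differentiable one_ne_zero).differentiableAt
      (hu'.differentiable one_ne_zero).differentiableAt]
    simp only [Prod.fst_add, CompactlySupportedContinuousMap.coe_add, Pi.add_apply, add_mul,
      Finset.sum_add_distrib, _root_.add_apply]
    linarith
  · have hi1 := integrable_max_sub (μ := μ) hc0 hc hn
    have hi2 := integrable_max_sub (μ := μ) hc0' hc' hn'
    have h1 : ∫ x, max (c + c' - (h x + h' x)) 0 ∂μ ≤
        ∫ x, max (c - h x) 0 ∂μ + ∫ x, max (c' - h' x) 0 ∂μ := by
      rw [← integral_add hi1 hi2]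
      refine integral_mono (integrable_max_sub (μ := μ) (add_nonneg hc0 hc0') (hc.add hc')
        fun x => add_nonneg (hn x) (hn' x)) (hi1.add hi2) fun x => ?_
      refine max_le ?_ (add_nonneg (le_max_right _ _) (le_max_right _ _))
      have := le_max_left (c - h x) 0
      have := le_max_left (c' - h' x) 0
      simp only
      linarith
    simp only [Prod.snd_add]
    linarith

lemma widthCone_smul {d : ℕ} {i : Fin d} {μ : Measure (Euc d)} {ε : ℝ}
    {p : TestData d × ℝ} (hp : p ∈ widthCone i μ ε) {a : ℝ} (ha : 0 ≤ a) :
    a • p ∈ widthCone i μ ε := by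
  obtain ⟨u, h, α, β, c, hu, hc, hn, hc0, hα, hβ, hF, ht⟩ := hp
  refine ⟨fun x => a * u x, fun x => a * h x, a * α, a * β, a * c, contDiff_const.mul hu,
    continuous_const.mul hc, fun x => mul_nonneg ha (hn x), mul_nonneg ha hc0, fun x => ?_,
    fun x => ?_, fun x v hv => ?_, ?_⟩
  · have := mul_le_mul_of_nonneg_left (hα x) ha
    simp only [Prod.smul_fst, Prod.smul_snd, CompactlySupportedContinuousMap.coe_smul,
      Pi.smul_apply, smul_eq_mul]
    linarith
  · have := mul_le_mul_of_nonneg_left (hβ x) ha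
    simp only [Prod.smul_fst, Prod.smul_snd, CompactlySupportedContinuousMap.coe_smul,
      Pi.smul_apply, smul_eq_mul]
    linarith
  · have := mul_le_mul_of_nonneg_left (hF x v hv) ha
    rw [fderiv_const_mul (hu.differentiable one_ne_zero).differentiableAt]
    simp only [Prod.smul_fst, CompactlySupportedContinuousMap.coe_smul, Pi.smul_apply, smul_eq_mul,
      mul_assoc, ← Finset.mul_sum, _root_.smul_apply]
    linarith
  · have h1 : ∀ x, max (a * c - a * h x) 0 = a * max (c - h x) 0 := fun x => by
      rw [mul_max_of_nonneg _ _ ha, mul_zero, mul_sub]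
    have := mul_le_mul_of_nonneg_left ht ha
    simp only [h1, integral_const_mul, Prod.smul_snd, smul_eq_mul]
    linarith

lemma nonneg_of_mem_widthCone {d : ℕ} {i : Fin d} {μ : Measure (Euc d)} {ε : ℝ}
    (H : ∀ u h, ∀ α β : ℝ, IsWidth i u h → (∀ x, u x ≤ α) → (∀ x, -u x ≤ β) →
      α + β ≤ ε → ε ≤ ∫ x, max (1 - h x) 0 ∂μ) {t : ℝ}
    (ht : ((0 : TestData d), t) ∈ widthCone i μ ε) : 0 ≤ t := by
  obtain ⟨u, h, α, β, c, hu, hc, hn, hc0, hα, hβ, hF, ht⟩ := ht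
  simp only [Prod.fst_zero, Prod.snd_zero, Pi.zero_apply, CompactlySupportedContinuousMap.coe_zero,
    add_zero, zero_mul, Finset.sum_const_zero, zero_sub] at hα hβ hF ht
  have hαβ : 0 ≤ α + β := by linarith [hα 0, hβ 0]
  have hbound : 0 ≤ ∫ x, max (c - h x) 0 ∂μ := integral_nonneg fun x => le_max_right _ _
  rcases hc0.eq_or_lt with h0 | hcpos
  · rw [← h0, zero_mul] at ht
    rw [← h0] at hbound
    linarith
  by_cases hle : α + β ≤ c * ε
  · have hci := inv_nonneg.2 hc0
    have := H (fun x => c⁻¹ * u x) (fun x => c⁻¹ * h x) (c⁻¹ * α) (c⁻¹ * β)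
      ⟨contDiff_const.mul hu, continuous_const.mul hc, fun x => mul_nonneg hci (hn x), by
        intro x v hv
        rw [fderiv_const_mul (hu.differentiable one_ne_zero).differentiableAt, mul_assoc]
        exact mul_le_mul_of_nonneg_left (hF x v hv) hci⟩
      (fun x => mul_le_mul_of_nonneg_left (hα x) hci)
      (fun x => by
        have := mul_le_mul_of_nonneg_left (hβ x) hci
        linarith)
      (by rw [← mul_add, inv_mul_le_iff₀ hcpos]; exact hle)
    have h1 : ∀ x, max (1 - c⁻¹ * h x) 0 = c⁻¹ * max (c - h x) 0 := fun x => by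
      rw [mul_max_of_nonneg _ _ hci, mul_zero, mul_sub, inv_mul_cancel₀ hcpos.ne']
    simp only [h1, integral_const_mul] at this
    rw [le_inv_mul_iff₀ hcpos] at this
    linarith
  · linarith

lemma exists_add_mem_widthCone {d : ℕ} (i : Fin d) (μ : Measure (Euc d)) (ε : ℝ)
    (p : TestData d) : ∃ t : ℝ, (p, t) ∈ widthCone i μ ε := by
  obtain ⟨F, a, b⟩ := p
  obtain ⟨A, hA⟩ := a.hasCompactSupport.exists_bound_of_continuous a.continuous
  obtain ⟨B, hB⟩ := b.hasCompactSupport.exists_bound_of_continuous b.continuous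
  choose M hM using fun k => (F k).hasCompactSupport.exists_bound_of_continuous (F k).continuous
  choose R hR using fun k => (F k).hasCompactSupport.isCompact.isBounded.subset_closedBall 0
  have hM0 : ∀ k, 0 ≤ M k := fun k => (norm_nonneg _).trans (hM k 0)
  set K : ℝ := ∑ k, 2 * M k * (1 + R k ^ 2) with hK
  have hK0 : 0 ≤ K := Finset.sum_nonneg fun k _ =>
    mul_nonneg (mul_nonneg zero_le_two (hM0 k)) (by positivity)
  have hder : ∀ x : Euc d, HasFDerivAt (fun x : Euc d => K * Real.arctan (x i))
      (K • ((1 / (1 + x i ^ 2)) • (EuclideanSpace.proj i : Euc d →L[ℝ] ℝ))) x := fun x =>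
    ((EuclideanSpace.proj i : Euc d →L[ℝ] ℝ).hasFDerivAt.arctan).const_mul K
  have harc : ∀ x : ℝ, |K * Real.arctan x| ≤ K * 2 := fun x => by
    rw [abs_mul, abs_of_nonneg hK0]
    refine mul_le_mul_of_nonneg_left (abs_le.2 ⟨?_, ?_⟩) hK0
    · linarith [Real.neg_pi_div_two_lt_arctan x, Real.pi_le_four]
    · linarith [Real.arctan_lt_pi_div_two x, Real.pi_le_four]
  refine ⟨_, fun x => K * Real.arctan (x i), fun _ => 0, K * 2 + A, K * 2 + B, 0, ?_,
    continuous_const, fun _ => le_rfl, le_rfl, fun x => ?_, fun x => ?_, fun x v hv => ?_, le_rfl⟩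
  · exact contDiff_const.mul (Real.contDiff_arctan.comp
      (EuclideanSpace.proj i : Euc d →L[ℝ] ℝ).contDiff)
  · have h1 := (abs_le.1 (harc (x i))).2
    have h2 := (abs_le.1 (hA x)).2
    simp only
    linarith
  · have h1 := (abs_le.1 (harc (x i))).1
    have h2 := (abs_le.1 (hB x)).2
    simp only
    linarith
  · have hvi := axisCone.nonneg hv
    rw [(hder x).fderiv]
    simp only [zero_mul, zero_add, _root_.smul_apply, smul_eq_mul, PiLp.proj_apply]
    rw [hK, Finset.sum_mul]
    refine Finset.sum_le_sum fun k _ => ?_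
    by_cases hx : x ∈ tsupport (F k)
    · have h1 : ‖x‖ ≤ R k := by simpa using hR k hx
      have h2 : x i ^ 2 ≤ R k ^ 2 := by
        rw [← sq_abs (x i)]
        exact pow_le_pow_left₀ (abs_nonneg _) ((PiLp.norm_apply_le x i).trans h1) 2
      have h3 : F k x * v k ≤ M k * (2 * v i) :=
        (le_abs_self _).trans (by
          rw [abs_mul]
          exact mul_le_mul (hM k x) (hv k) (abs_nonneg _) (hM0 k))
      refine h3.trans ?_
      have h4 : (1 : ℝ) ≤ (1 + R k ^ 2) * (1 / (1 + x i ^ 2)) := by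
        rw [mul_one_div, one_le_div (by positivity)]
        linarith
      calc M k * (2 * v i) = (2 * M k * v i) * 1 := by ring
        _ ≤ (2 * M k * v i) * ((1 + R k ^ 2) * (1 / (1 + x i ^ 2))) :=
          mul_le_mul_of_nonneg_left h4 (mul_nonneg (mul_nonneg zero_le_two (hM0 k)) hvi)
        _ = _ := by ring
    · rw [image_eq_zero_of_notMem_tsupport hx, zero_mul]
      have := hM0 k
      positivity

/-- Duality: a linear functional on test data bounded by the cone. -/
lemma exists_functional_le {d : ℕ} {i : Fin d} {μ : Measure (Euc d)} [IsFiniteMeasure μ] {ε : ℝ}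
    (H : ∀ u h, ∀ α β : ℝ, IsWidth i u h → (∀ x, u x ≤ α) → (∀ x, -u x ≤ β) →
      α + β ≤ ε → ε ≤ ∫ x, max (1 - h x) 0 ∂μ) :
    ∃ T : TestData d →ₗ[ℝ] ℝ, ∀ p t, (p, t) ∈ widthCone i μ ε → T p ≤ t := by
  have h0 : (0 : TestData d × ℝ) ∈ widthCone i μ ε := by
    obtain ⟨t, ht⟩ := exists_add_mem_widthCone i μ ε 0
    simpa using widthCone_smul ht le_rfl
  let s : PointedCone ℝ (TestData d × ℝ) :=
    { carrier := widthCone i μ ε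
      zero_mem' := h0
      smul_mem' := fun c _ hx => widthCone_smul hx c.2
      add_mem' := fun hx hy => widthCone_add hx hy }
  let f : (TestData d × ℝ) →ₗ.[ℝ] ℝ :=
    { domain := LinearMap.ker (LinearMap.fst ℝ (TestData d) ℝ)
      toFun := (LinearMap.snd ℝ (TestData d) ℝ).domRestrict _ }
  obtain ⟨g, hg1, hg2⟩ := riesz_extension s f
    (fun x hx => by
      obtain ⟨⟨y, t⟩, hy⟩ := x
      have : y = 0 := hy
      subst this
      exact nonneg_of_mem_widthCone H hx)
    (fun y => by
      obtain ⟨t, ht⟩ := exists_add_mem_widthCone i μ ε y.1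
      refine ⟨⟨(0, t - y.2), rfl⟩, ?_⟩
      have : ((0 : TestData d), t - y.2) + y = (y.1, t) := by ext1 <;> simp
      change ((0 : TestData d), t - y.2) + y ∈ widthCone i μ ε
      rwa [this])
  have hg3 : ∀ t : ℝ, g (0, t) = t := fun t => hg1 ⟨(0, t), rfl⟩
  refine ⟨-(g.comp (LinearMap.inl ℝ (TestData d) ℝ)), fun p t hpt => ?_⟩
  have h1 : 0 ≤ g (p, t) := hg2 _ hpt
  have h2 : (p, t) = (p, (0 : ℝ)) + ((0 : TestData d), t) := by simp
  rw [h2, map_add, hg3] at h1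
  simp only [LinearMap.neg_apply, LinearMap.comp_apply, LinearMap.inl_apply]
  linarith

lemma not_mutuallySingular_of_le_integral {d : ℕ} {P μ : Measure (Euc d)}
    [IsLocallyFiniteMeasure P] [IsFiniteMeasure μ] {ε : ℝ} (hε : 0 < ε)
    (h : ∀ φ : C_c(Euc d, ℝ), (∀ x, 0 ≤ φ x) →
      ε ≤ ∫ x, φ x ∂P + ∫ x, max (1 - φ x) 0 ∂μ) : ¬ P ⟂ₘ μ := by
  rintro ⟨A, hA, hPA, hμA⟩
  have hε3 : ENNReal.ofReal (ε / 3) ≠ 0 := by simpa using hε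
  obtain ⟨K, hKA, hK, hKε⟩ := hA.exists_isCompact_sdiff_lt (measure_ne_top μ A) hε3
  obtain ⟨U, hKU, hU, hUε⟩ := K.exists_isOpen_lt_of_lt (μ := P) (ENNReal.ofReal (ε / 3)) (by
    rw [measure_mono_null hKA hPA]
    exact pos_iff_ne_zero.2 hε3)
  obtain ⟨f, hf1, hf0, hfc, hf⟩ := exists_continuous_one_zero_of_isCompact hK hU.isClosed_compl
    (Set.disjoint_compl_right_iff_subset.2 hKU)
  have hKc : μ Kᶜ < ENNReal.ofReal (ε / 3) := by
    refine lt_of_le_of_lt ?_ hKε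
    calc μ Kᶜ ≤ μ (A \ K ∪ Aᶜ) := measure_mono fun x hx => by
          by_cases hxA : x ∈ A
          · exact Or.inl ⟨hxA, hx⟩
          · exact Or.inr hxA
      _ ≤ μ (A \ K) + μ Aᶜ := measure_union_le _ _
      _ = μ (A \ K) := by rw [hμA, add_zero]
  have h1 : ∫ x, f x ∂P ≤ P.real U := by
    rw [← integral_indicator_one hU.measurableSet]
    refine integral_mono (f.continuous.integrable_of_hasCompactSupport hfc)
      ((integrable_indicator_iff hU.measurableSet).2 (integrableOn_const hUε.ne_top)) fun x => ?_
    by_cases hx : x ∈ U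
    · simpa [hx] using (hf x).2
    · simpa [hx] using (hf0 hx).le
  have h2 : ∫ x, max (1 - f x) 0 ∂μ ≤ μ.real Kᶜ := by
    rw [← integral_indicator_one hK.isClosed.measurableSet.compl]
    refine integral_mono (integrable_max_sub zero_le_one f.continuous fun x => (hf x).1)
      ((integrable_indicator_iff hK.isClosed.measurableSet.compl).2
        (integrableOn_const (measure_ne_top _ _))) fun x => ?_
    by_cases hx : x ∈ K
    · simp [hx, hf1 hx]
    · simpa [hx] using (hf x).1
  have h3 : P.real U < ε / 3 := (ENNReal.toReal_lt_of_lt_ofReal hUε)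
  have h4 : μ.real Kᶜ < ε / 3 := (ENNReal.toReal_lt_of_lt_ofReal hKc)
  have h5 : ε ≤ ∫ x, f x ∂P + ∫ x, max (1 - f x) 0 ∂μ := h ⟨f, hfc⟩ fun x => (hf x).1
  linarith

/-- If `μ` has no thin widths along `axisCone i`, then it is not singular to some component of
a vector field whose divergence is a measure. -/
lemma exists_measures_of_width {d : ℕ} {i : Fin d} {μ : Measure (Euc d)} [IsFiniteMeasure μ]
    {ε : ℝ} (hε : 0 < ε)
    (H : ∀ u h, ∀ α β : ℝ, IsWidth i u h → (∀ x, u x ≤ α) → (∀ x, -u x ≤ β) →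
      α + β ≤ ε → ε ≤ ∫ x, max (1 - h x) 0 ∂μ) :
    ∃ (P : Fin d → Measure (Euc d)) (c : Fin d → ℝ) (l₁ l₂ : Measure (Euc d)),
      (∀ k, IsLocallyFiniteMeasure (P k)) ∧ IsLocallyFiniteMeasure l₁ ∧
      IsLocallyFiniteMeasure l₂ ∧ c i = 0 ∧ ¬ P i ⟂ₘ μ ∧
      ∀ ψ : Euc d → ℝ, ContDiff ℝ 1 ψ → HasCompactSupport ψ →
        ∑ k, (∫ x, fderiv ℝ ψ x (EuclideanSpace.single k 1) ∂P k -
          c k * ∫ x, fderiv ℝ ψ x (EuclideanSpace.single k 1) ∂P i) =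
        ∫ x, ψ x ∂l₁ - ∫ x, ψ x ∂l₂ := by
  obtain ⟨T, hT⟩ := exists_functional_le H
  have hT0 : ∀ (F : Fin d → C_c(Euc d, ℝ)) (a b : C_c(Euc d, ℝ)) (u : Euc d → ℝ),
      ContDiff ℝ 1 u → (∀ x, u x + a x ≤ 0) → (∀ x, b x - u x ≤ 0) →
      (∀ x, ∀ v ∈ axisCone i, ∑ k, F k x * v k ≤ fderiv ℝ u x v) → T (F, a, b) ≤ 0 := by
    intro F a b u hu ha hb hF
    refine hT _ _ ⟨u, fun _ => 0, 0, 0, 0, hu, continuous_const, fun _ => le_rfl, le_rfl, ha, hb,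
      fun x v hv => by simpa using hF x v hv, by simp⟩
  let τ : Fin d → C_c(Euc d, ℝ) →ₗ[ℝ] ℝ := fun k =>
    T ∘ₗ LinearMap.inl ℝ _ _ ∘ₗ LinearMap.single ℝ (fun _ : Fin d => C_c(Euc d, ℝ)) k
  let c : Fin d → ℝ := fun k => if k = i then 0 else 2
  have hci : c i = 0 := by simp [c]
  have hpos : ∀ k (φ : C_c(Euc d, ℝ)), (∀ x, 0 ≤ φ x) → 0 ≤ (τ k + c k • τ i) φ := by
    intro k φ hφ
    have h1 : (τ k + c k • τ i) φ =
        -T (Pi.single k (-φ) + Pi.single i (-(c k • φ)), 0, 0) := by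
      have : ((Pi.single k (-φ) + Pi.single i (-(c k • φ)), 0, 0) : TestData d) =
          -((Pi.single k φ, 0, 0) + c k • ((Pi.single i φ, 0, 0) : TestData d)) := by
        refine Prod.ext ?_ (by simp)
        simp only [Prod.fst_neg, Prod.fst_add, Prod.smul_fst, neg_add, Pi.single_neg]
        exact congrArg (-Pi.single k φ + -·)
          ((LinearMap.single ℝ (fun _ : Fin d => C_c(Euc d, ℝ)) i).map_smul (c k) φ)
      rw [this, map_neg, map_add, map_smul, neg_neg]
      rfl
    rw [h1, neg_nonneg]
    refine hT0 _ _ _ (fun _ => 0) contDiff_const (by simp) (by simp) fun x v hv => ?_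
    have h2 : ∀ (j : Fin d) (χ : C_c(Euc d, ℝ)),
        ∑ l, (Pi.single j χ : Fin d → C_c(Euc d, ℝ)) l x * v l = χ x * v j := by
      intro j χ
      rw [Finset.sum_eq_single j]
      · simp
      · intro l _ hl
        simp [Pi.single_eq_of_ne hl]
      · simp
    simp only [Pi.add_apply, CompactlySupportedContinuousMap.coe_add, add_mul,
      Finset.sum_add_distrib, h2, CompactlySupportedContinuousMap.coe_neg, Pi.neg_apply,
      CompactlySupportedContinuousMap.coe_smul, Pi.smul_apply, smul_eq_mul, fderiv_const_apply,
      _root_.zero_apply]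
    have h3 : 0 ≤ v k + c k * v i := by
      by_cases hk : k = i
      · simp [hk, hci, axisCone.nonneg hv]
      · simp only [c, hk, if_false]
        linarith [(abs_le.1 (hv k)).1]
    linarith [mul_nonneg (hφ x) h3]
  choose P hP1 hP2 using fun k => exists_measure_of_nonneg_functional _ (hpos k)
  obtain ⟨l₁, hl1, hl1'⟩ := exists_measure_of_nonneg_functional
    (T ∘ₗ LinearMap.inr ℝ _ _ ∘ₗ LinearMap.inl ℝ _ _) (fun φ hφ => by
      have h1 := hT0 0 (-φ) 0 (fun _ => 0) contDiff_const
        (fun x => by simpa using hφ x) (by simp) (by simp)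
      have h2 : ((0, -φ, 0) : TestData d) = -(0, φ, 0) := by simp
      rw [h2, map_neg] at h1
      exact neg_nonpos.1 h1)
  obtain ⟨l₂, hl2, hl2'⟩ := exists_measure_of_nonneg_functional
    (T ∘ₗ LinearMap.inr ℝ _ _ ∘ₗ LinearMap.inr ℝ _ _) (fun φ hφ => by
      have h1 := hT0 0 0 (-φ) (fun _ => 0) contDiff_const
        (by simp) (fun x => by simpa using hφ x) (by simp)
      have h2 : ((0, 0, -φ) : TestData d) = -(0, 0, φ) := by simp
      rw [h2, map_neg] at h1
      exact neg_nonpos.1 h1)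
  have hPi : ∀ φ : C_c(Euc d, ℝ), ∫ x, φ x ∂P i = τ i φ := fun φ => by
    rw [hP2, hci, zero_smul, add_zero]
  refine ⟨P, c, l₁, l₂, hP1, hl1, hl2, hci, ?_, ?_⟩
  · refine not_mutuallySingular_of_le_integral hε fun φ hφ => ?_
    have h1 := hT (Pi.single i (-φ), 0, 0) (∫ x, max (1 - φ x) 0 ∂μ + (0 + 0) - 1 * ε)
      ⟨fun _ => 0, φ, 0, 0, 1, contDiff_const, φ.continuous, hφ, zero_le_one, by simp, by simp,
        fun x v hv => by
          rw [Finset.sum_eq_single i (fun l _ hl => by simp [Pi.single_eq_of_ne hl]) (by simp)]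
          simp, le_rfl⟩
    have h2 : ((Pi.single i (-φ), 0, 0) : TestData d) = -(Pi.single i φ, 0, 0) := by
      simp [Pi.single_neg]
    have h3 : T (Pi.single i φ, 0, 0) = τ i φ := rfl
    rw [h2, map_neg, h3, ← hPi] at h1
    linarith
  · intro ψ hψ hψc
    let F : Fin d → C_c(Euc d, ℝ) := fun k =>
      ⟨⟨fun x => fderiv ℝ ψ x (EuclideanSpace.single k 1),
        (hψ.continuous_fderiv one_ne_zero).clm_apply continuous_const⟩, hψc.fderiv_apply ℝ _⟩
    let Ψ : C_c(Euc d, ℝ) := ⟨⟨ψ, hψ.continuous⟩, hψc⟩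
    have hFv : ∀ x (v : Euc d), ∑ k, F k x * v k = fderiv ℝ ψ x v := by
      intro x v
      have hv : v = ∑ k, v k • EuclideanSpace.single k (1 : ℝ) := by
        simpa using ((EuclideanSpace.basisFun (Fin d) ℝ).sum_repr v).symm
      conv_rhs => rw [hv, map_sum]
      refine Finset.sum_congr rfl fun k _ => ?_
      rw [map_smul, smul_eq_mul, mul_comm]
      rfl
    have h1 : T (F, -Ψ, Ψ) ≤ 0 := hT0 F (-Ψ) Ψ ψ hψ (fun x => (add_neg_cancel (ψ x)).le)
      (fun x => (sub_self (ψ x)).le) fun x v _ => (hFv x v).le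
    have h2 : T (-F, Ψ, -Ψ) ≤ 0 := by
      refine hT0 (-F) Ψ (-Ψ) (fun x => - ψ x) hψ.neg (fun x => (neg_add_cancel (ψ x)).le)
        (fun x => (sub_self (-ψ x)).le) fun x v _ => ?_
      rw [fderiv_fun_neg, _root_.neg_apply, ← hFv]
      simp
    have h3 : T (-F, Ψ, -Ψ) = - T (F, -Ψ, Ψ) := by
      rw [← map_neg]
      simp
    have h4 : T (F, -Ψ, Ψ) = T (F, 0, 0) - T (0, Ψ, 0) + T (0, 0, Ψ) := by
      rw [← map_sub, ← map_add]
      simp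
    have h5 : T (F, 0, 0) = ∑ k, τ k (F k) := by
      have : (F, 0, 0) = ∑ k, ((Pi.single k (F k), 0, 0) : TestData d) := by
        refine Prod.ext ?_ (Prod.ext ?_ ?_)
        · rw [Prod.fst_sum, Finset.univ_sum_single]
        · simp [Prod.snd_sum]
        · simp [Prod.snd_sum]
      rw [this, map_sum]
      rfl
    have h6 : ∀ k, ∫ x, fderiv ℝ ψ x (EuclideanSpace.single k 1) ∂P k -
          c k * ∫ x, fderiv ℝ ψ x (EuclideanSpace.single k 1) ∂P i = τ k (F k) := by
      intro k
      have e1 : ∫ x, fderiv ℝ ψ x (EuclideanSpace.single k 1) ∂P k = _ := hP2 k (F k)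
      have e2 : ∫ x, fderiv ℝ ψ x (EuclideanSpace.single k 1) ∂P i = _ := hPi (F k)
      rw [e1, e2]
      simp
    have h7 : ∫ x, ψ x ∂l₁ = T (0, Ψ, 0) := hl1' Ψ
    have h8 : ∫ x, ψ x ∂l₂ = T (0, 0, Ψ) := hl2' Ψ
    rw [Finset.sum_congr rfl fun k _ => h6 k, h7, h8]
    linarith

/-- Comparison of two measures on a ball, for a test function supported there. -/
lemma abs_integral_sub_le {d : ℕ} {ν μ : Measure (Euc d)} [IsLocallyFiniteMeasure ν]
    [IsLocallyFiniteMeasure μ] {x : Euc d} {ρ h M : ℝ} {g : Euc d → ℝ} (hg : Continuous g)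
    (hM : ∀ y, |g y| ≤ M) (hg0 : ∀ y, y ∉ closedBall x ρ → g y = 0) :
    |∫ y, g y ∂ν - h * ∫ y, g y ∂μ| ≤ M * ((ν.singularPart μ) (closedBall x ρ)).toReal +
      M * (∫⁻ y in closedBall x ρ, ‖(ν.rnDeriv μ y).toReal - h‖ₑ ∂μ).toReal := by
  have hM0 : 0 ≤ M := (abs_nonneg _).trans (hM x)
  have hgc : HasCompactSupport g :=
    HasCompactSupport.intro (isCompact_closedBall x ρ) hg0
  have hgi : ∀ (κ : Measure (Euc d)) [IsLocallyFiniteMeasure κ], Integrable g κ := fun κ _ =>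
    hg.integrable_of_hasCompactSupport hgc
  have hB : ∀ (κ : Measure (Euc d)) [IsLocallyFiniteMeasure κ], κ (closedBall x ρ) < ∞ :=
    fun κ _ => (isCompact_closedBall x ρ).measure_lt_top
  have hD : IntegrableOn (fun y => (ν.rnDeriv μ y).toReal) (closedBall x ρ) μ :=
    Measure.integrableOn_toReal_rnDeriv (hB ν).ne
  have hs : IsLocallyFiniteMeasure (ν.singularPart μ) := inferInstance
  have hw : IsLocallyFiniteMeasure (μ.withDensity (ν.rnDeriv μ)) := by infer_instance
  have e1 : ∫ y, g y ∂ν = ∫ y, g y ∂(ν.singularPart μ) +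
      ∫ y, g y ∂(μ.withDensity (ν.rnDeriv μ)) := by
    rw [← integral_add_measure (hgi _) (hgi _), Measure.singularPart_add_rnDeriv]
  have e2 : ∫ y, g y ∂(μ.withDensity (ν.rnDeriv μ)) =
      ∫ y, (ν.rnDeriv μ y).toReal * g y ∂μ := by
    rw [integral_withDensity_eq_integral_toReal_smul (Measure.measurable_rnDeriv _ _)
      (Measure.rnDeriv_lt_top _ _)]
    rfl
  have hDB : IntegrableOn (fun y => (ν.rnDeriv μ y).toReal - h) (closedBall x ρ) μ :=
    hD.sub (integrableOn_const (hB μ).ne)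
  have hsupp : Function.support (fun y => (ν.rnDeriv μ y).toReal * g y) ⊆ closedBall x ρ := by
    intro y hy
    by_contra hyB
    exact hy (by simp [hg0 y hyB])
  have e3 : ∫ y, (ν.rnDeriv μ y).toReal * g y ∂μ - h * ∫ y, g y ∂μ =
      ∫ y in closedBall x ρ, ((ν.rnDeriv μ y).toReal - h) * g y ∂μ := by
    rw [setIntegral_eq_integral_of_forall_compl_eq_zero (fun y hy => by simp [hg0 y hy]),
      ← integral_const_mul, ← integral_sub _ ((hgi μ).const_mul h)]
    · simp only [sub_mul]
    · rw [← integrableOn_iff_integrable_of_support_subset hsupp]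
      exact hD.mul_bdd (c := M) hg.aestronglyMeasurable (ae_of_all _ hM)
  have e4 : |∫ y, g y ∂(ν.singularPart μ)| ≤
      M * ((ν.singularPart μ) (closedBall x ρ)).toReal := by
    rw [← setIntegral_eq_integral_of_forall_compl_eq_zero hg0, ← Real.norm_eq_abs]
    exact norm_setIntegral_le_of_norm_le_const (hB _) fun y _ => hM y
  have e5 : |∫ y in closedBall x ρ, ((ν.rnDeriv μ y).toReal - h) * g y ∂μ| ≤
      M * (∫⁻ y in closedBall x ρ, ‖(ν.rnDeriv μ y).toReal - h‖ₑ ∂μ).toReal := by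
    rw [← integral_norm_eq_lintegral_enorm hDB.1, ← integral_const_mul, ← Real.norm_eq_abs]
    refine norm_integral_le_of_norm_le (hDB.norm.const_mul M) (ae_of_all _ fun y => ?_)
    rw [norm_mul, mul_comm]
    exact mul_le_mul_of_nonneg_right (hM y) (norm_nonneg _)
  calc |∫ y, g y ∂ν - h * ∫ y, g y ∂μ| = |∫ y, g y ∂(ν.singularPart μ) +
        ∫ y in closedBall x ρ, ((ν.rnDeriv μ y).toReal - h) * g y ∂μ| := by
        rw [e1, e2, ← e3, add_sub_assoc]
    _ ≤ _ := (abs_add_le _ _).trans (add_le_add e4 e5)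

/-- The normalised blow-up of `ν` at `x`, tested against `G`, relative to the mass of `μ`. -/
def blowup {d : ℕ} (μ ν : Measure (Euc d)) (x : Euc d) (R : ℝ) (G : Euc d → ℝ) (r : ℝ) : ℝ :=
  (∫ y, G (r⁻¹ • (y - x)) ∂ν) / (μ (closedBall x (R * r))).toReal

lemma mem_closedBall_of_rescale {d : ℕ} {x y : Euc d} {R r : ℝ} (hr : 0 < r)
    (hy : r⁻¹ • (y - x) ∈ closedBall (0 : Euc d) R) : y ∈ closedBall x (R * r) := by
  rw [mem_closedBall, dist_eq_norm] at hy ⊢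
  rw [sub_zero, norm_smul, norm_inv, Real.norm_of_nonneg hr.le, inv_mul_le_iff₀ hr] at hy
  linarith

lemma tendsto_const_mul_nhdsGT_zero {R : ℝ} (hR : 0 < R) :
    Tendsto (fun r : ℝ => R * r) (nhdsWithin 0 (Set.Ioi 0)) (nhdsWithin 0 (Set.Ioi 0)) := by
  refine tendsto_nhdsWithin_iff.2 ⟨?_, ?_⟩
  · have : Tendsto (fun r : ℝ => R * r) (nhds 0) (nhds (R * 0)) := tendsto_id.const_mul R
    rw [mul_zero] at this
    exact this.mono_left nhdsWithin_le_nhds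
  · filter_upwards [self_mem_nhdsWithin] with r hr
    exact mul_pos hR hr

lemma tendsto_blowup_sub {d : ℕ} (μ ν : Measure (Euc d)) [IsLocallyFiniteMeasure ν]
    [IsLocallyFiniteMeasure μ] :
    ∀ᵐ x ∂μ, ∀ (R : ℝ) (G : Euc d → ℝ), 0 < R → Continuous G →
      (∀ y, y ∉ closedBall 0 R → G y = 0) →
      Tendsto (fun r => blowup μ ν x R G r - (ν.rnDeriv μ x).toReal * blowup μ μ x R G r)
        (nhdsWithin 0 (Set.Ioi 0)) (nhds 0) := by
  have hloc : LocallyIntegrable (fun y => (ν.rnDeriv μ y).toReal) μ := fun x => by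
    obtain ⟨U, hU, hU'⟩ := ν.finiteAt_nhds x
    exact ⟨U, hU, Measure.integrableOn_toReal_rnDeriv hU'.ne⟩
  filter_upwards [(Besicovitch.vitaliFamily μ).ae_eventually_measure_zero_of_singular
      (Measure.mutuallySingular_singularPart ν μ),
    (Besicovitch.vitaliFamily μ).ae_tendsto_lintegral_enorm_sub_div hloc] with x hx1 hx2
  intro R G hR hG hG0
  have hball := (Besicovitch.tendsto_filterAt μ x).comp (tendsto_const_mul_nhdsGT_zero hR)
  have h1 := (ENNReal.tendsto_toReal ENNReal.zero_ne_top).comp (hx1.comp hball)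
  have h2 := (ENNReal.tendsto_toReal ENNReal.zero_ne_top).comp (hx2.comp hball)
  obtain ⟨M, hM⟩ := (HasCompactSupport.intro (isCompact_closedBall 0 R)
    hG0).exists_bound_of_continuous hG
  have h3 := (h1.const_mul M).add (h2.const_mul M)
  simp only [ENNReal.toReal_zero, mul_zero, add_zero] at h3
  refine squeeze_zero_norm' ?_ h3
  filter_upwards [self_mem_nhdsWithin] with r (hr : 0 < r)
  have key := abs_integral_sub_le (ν := ν) (μ := μ) (x := x) (ρ := R * r) (M := M)
    (h := (ν.rnDeriv μ x).toReal) (g := fun y => G (r⁻¹ • (y - x)))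
    (hG.comp (by fun_prop)) (fun y => hM _) (fun y hy => hG0 _ fun hy' => hy ?_)
  · simp only [Function.comp_apply, ENNReal.toReal_div, blowup]
    rw [mul_div_assoc', ← sub_div, norm_div, mul_div_assoc', mul_div_assoc', ← add_div,
      Real.norm_eq_abs, Real.norm_eq_abs, abs_of_nonneg ENNReal.toReal_nonneg]
    gcongr
  · exact mem_closedBall_of_rescale hr hy'

lemma abs_blowup_le {d : ℕ} {μ : Measure (Euc d)} [IsLocallyFiniteMeasure μ] {x : Euc d}
    {R M : ℝ} {G : Euc d → ℝ} (hM : ∀ y, |G y| ≤ M) (hG0 : ∀ y, y ∉ closedBall 0 R → G y = 0)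
    {r : ℝ} (hr : 0 < r) : |blowup μ μ x R G r| ≤ M := by
  have hM0 : 0 ≤ M := (abs_nonneg _).trans (hM 0)
  rw [blowup, abs_div, abs_of_nonneg ENNReal.toReal_nonneg]
  refine div_le_of_le_mul₀ ENNReal.toReal_nonneg hM0 ?_
  rw [← setIntegral_eq_integral_of_forall_compl_eq_zero (s := closedBall x (R * r)),
    ← Real.norm_eq_abs]
  · exact norm_setIntegral_le_of_norm_le_const (isCompact_closedBall _ _).measure_lt_top
      fun y _ => hM _
  · refine fun y hy => hG0 _ fun hy' => hy ?_
    exact mem_closedBall_of_rescale hr hy'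

lemma hasFDerivAt_comp_rescale {d : ℕ} {ψ : Euc d → ℝ} (hψ : ContDiff ℝ 1 ψ) (x y : Euc d)
    (r : ℝ) : HasFDerivAt (fun y => ψ (r⁻¹ • (y - x))) (r⁻¹ • fderiv ℝ ψ (r⁻¹ • (y - x))) y := by
  have h1 : HasFDerivAt (fun y : Euc d => r⁻¹ • (y - x)) (r⁻¹ • ContinuousLinearMap.id ℝ (Euc d))
      y := ((hasFDerivAt_id y).sub_const x).const_smul r⁻¹
  have h2 := ((hψ.differentiable one_ne_zero) (r⁻¹ • (y - x))).hasFDerivAt.comp y h1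
  refine h2.congr_fderiv ?_
  ext v
  simp

/-- If the divergence of a vector measure with a component not singular to `μ` is a measure,
then on a set of positive measure the blow-ups of `μ` are invariant in some direction. -/
lemma exists_frequently_tendsto_blowup {d : ℕ} {i : Fin d} {μ : Measure (Euc d)}
    [IsLocallyFiniteMeasure μ] {P : Fin d → Measure (Euc d)} {c : Fin d → ℝ}
    {l₁ l₂ : Measure (Euc d)} [∀ k, IsLocallyFiniteMeasure (P k)] [IsLocallyFiniteMeasure l₁]
    [IsLocallyFiniteMeasure l₂] (hci : c i = 0) (hP : ¬ P i ⟂ₘ μ)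
    (hdiv : ∀ ψ : Euc d → ℝ, ContDiff ℝ 1 ψ → HasCompactSupport ψ →
        ∑ k, (∫ x, fderiv ℝ ψ x (EuclideanSpace.single k 1) ∂P k -
          c k * ∫ x, fderiv ℝ ψ x (EuclideanSpace.single k 1) ∂P i) =
        ∫ x, ψ x ∂l₁ - ∫ x, ψ x ∂l₂) :
    ∃ᵐ x ∂μ, ∃ v : Euc d, v i = 1 ∧ ∀ (R : ℝ) (ψ : Euc d → ℝ), 0 < R → ContDiff ℝ 1 ψ →
      (∀ y, y ∉ closedBall 0 R → ψ y = 0) →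
      Tendsto (blowup μ μ x R fun y => fderiv ℝ ψ y v) (nhdsWithin 0 (Set.Ioi 0)) (nhds 0) := by
  have hfreq : ∃ᵐ x ∂μ, (P i).rnDeriv μ x ≠ 0 := by
    intro h
    refine hP ((Measure.rnDeriv_eq_zero _ _).1 ?_)
    filter_upwards [h] with x hx
    simpa using hx
  have hall := (ae_all_iff.2 fun k => tendsto_blowup_sub μ (P k)).and
    ((tendsto_blowup_sub μ l₁).and ((tendsto_blowup_sub μ l₂).and (Measure.rnDeriv_lt_top (P i) μ)))
  refine (hfreq.and_eventually hall).mono ?_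
  rintro x ⟨hx0, hPx, hl1, hl2, hxt⟩
  set H : Fin d → ℝ := fun k => ((P k).rnDeriv μ x).toReal with hH
  have hHi : 0 < H i := ENNReal.toReal_pos hx0 hxt.ne
  refine ⟨WithLp.toLp 2 fun k => (H k - c k * H i) / H i, ?_, ?_⟩
  · simp [hci, hHi.ne']
  intro R ψ hR hψ hψ0
  have hψc : HasCompactSupport ψ := HasCompactSupport.intro (isCompact_closedBall 0 R) hψ0
  set G : Fin d → Euc d → ℝ := fun k y => fderiv ℝ ψ y (EuclideanSpace.single k 1) with hG
  have hGc : ∀ k, Continuous (G k) := fun k =>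
    (hψ.continuous_fderiv one_ne_zero).clm_apply continuous_const
  have hsupp : tsupport ψ ⊆ closedBall 0 R :=
    closure_minimal (fun y hy => by_contra fun h => hy (hψ0 y h)) isClosed_closedBall
  have hG0 : ∀ k y, y ∉ closedBall 0 R → G k y = 0 := fun k y hy => by
    have : fderiv ℝ ψ y = 0 :=
      image_eq_zero_of_notMem_tsupport fun h => hy (hsupp (tsupport_fderiv_subset ℝ h))
    simp [hG, this]
  obtain ⟨M, hM⟩ := hψc.exists_bound_of_continuous hψ.continuous
  have hid : Tendsto (fun r : ℝ => r) (nhdsWithin 0 (Set.Ioi 0)) (nhds 0) :=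
    tendsto_id.mono_left nhdsWithin_le_nhds
  have hl : ∀ l : Measure (Euc d), Tendsto (fun r => blowup μ l x R ψ r -
      (l.rnDeriv μ x).toReal * blowup μ μ x R ψ r) (nhdsWithin 0 (Set.Ioi 0)) (nhds 0) →
      Tendsto (fun r => r * blowup μ l x R ψ r) (nhdsWithin 0 (Set.Ioi 0)) (nhds 0) := by
    intro l hl
    have h1 : Tendsto (fun r => r * blowup μ μ x R ψ r) (nhdsWithin 0 (Set.Ioi 0)) (nhds 0) := by
      have : Tendsto (fun r : ℝ => r * M) (nhdsWithin 0 (Set.Ioi 0)) (nhds 0) := by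
        simpa using hid.mul_const M
      refine squeeze_zero_norm' ?_ this
      filter_upwards [self_mem_nhdsWithin] with r (hr : 0 < r)
      rw [norm_mul, Real.norm_of_nonneg hr.le]
      exact mul_le_mul_of_nonneg_left (abs_blowup_le hM hψ0 hr) hr.le
    have h2 := (hid.mul hl).add (h1.const_mul (l.rnDeriv μ x).toReal)
    simp only [mul_zero, add_zero] at h2
    refine h2.congr fun r => ?_
    ring
  have h1 := tendsto_finsetSum Finset.univ fun k _ =>
    ((hPx k R (G k) hR (hGc k) (hG0 k)).sub ((hPx i R (G k) hR (hGc k) (hG0 k)).const_mul (c k)))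
  have h2 := (hl l₁ (hl1 R ψ hR hψ.continuous hψ0)).sub (hl l₂ (hl2 R ψ hR hψ.continuous hψ0))
  have h3 := (h2.sub h1).const_mul (H i)⁻¹
  simp only [mul_zero, sub_zero, Finset.sum_const_zero] at h3
  refine h3.congr' ?_
  filter_upwards [self_mem_nhdsWithin] with r (hr : 0 < r)
  have e1 : r * (∫ y, ψ (r⁻¹ • (y - x)) ∂l₁ - ∫ y, ψ (r⁻¹ • (y - x)) ∂l₂) =
      ∑ k, (∫ y, G k (r⁻¹ • (y - x)) ∂P k - c k * ∫ y, G k (r⁻¹ • (y - x)) ∂P i) := by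
    rw [← hdiv (fun y => ψ (r⁻¹ • (y - x))) (hψ.comp (by fun_prop))
      (HasCompactSupport.intro (isCompact_closedBall x (R * r)) fun y hy => hψ0 _ fun hy' => hy ?_),
      Finset.mul_sum]
    · refine Finset.sum_congr rfl fun k _ => ?_
      have e2 : ∀ y, fderiv ℝ (fun y => ψ (r⁻¹ • (y - x))) y (EuclideanSpace.single k 1) =
          r⁻¹ * G k (r⁻¹ • (y - x)) := fun y => by
        rw [(hasFDerivAt_comp_rescale hψ x y r).fderiv]
        simp [hG]
      simp only [e2, integral_const_mul]
      field_simp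
    · exact mem_closedBall_of_rescale hr hy'
  have e3 : r * blowup μ l₁ x R ψ r - r * blowup μ l₂ x R ψ r =
      ∑ k, (blowup μ (P k) x R (G k) r - c k * blowup μ (P i) x R (G k) r) := by
    simp only [blowup]
    rw [← mul_sub, ← sub_div, mul_div_assoc', e1, Finset.sum_div]
    refine Finset.sum_congr rfl fun k _ => ?_
    ring
  have e4 : blowup μ μ x R (fun y => fderiv ℝ ψ y
      (WithLp.toLp 2 fun k => (H k - c k * H i) / H i)) r =
      ∑ k, (H k - c k * H i) / H i * blowup μ μ x R (G k) r := by
    have e5 : ∀ y (v : Euc d), fderiv ℝ ψ y v = ∑ k, v k * G k y := by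
      intro y v
      have hv : v = ∑ k, v k • EuclideanSpace.single k (1 : ℝ) := by
        simpa using ((EuclideanSpace.basisFun (Fin d) ℝ).sum_repr v).symm
      conv_lhs => rw [hv, map_sum]
      exact Finset.sum_congr rfl fun k _ => by rw [map_smul, smul_eq_mul]
    simp only [e5, blowup]
    rw [integral_finsetSum, Finset.sum_div]
    · refine Finset.sum_congr rfl fun k _ => ?_
      rw [integral_const_mul, mul_div_assoc]
    · intro k _
      refine Integrable.const_mul (Continuous.integrable_of_hasCompactSupport
        ((hGc k).comp (by fun_prop)) (HasCompactSupport.intro (isCompact_closedBall x (R * r))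
          fun y hy => hG0 k _ fun hy' => hy ?_)) _
      exact mem_closedBall_of_rescale hr hy'
  rw [e4, e3, ← Finset.sum_sub_distrib, Finset.mul_sum]
  refine Finset.sum_congr rfl fun k _ => ?_
  simp only [hH]
  ring

lemma det_adjoint_eq {d : ℕ} (f : Euc d →ₗ[ℝ] Euc d) :
    LinearMap.det (LinearMap.adjoint f) = LinearMap.det f := by
  rw [← LinearMap.det_toMatrix (EuclideanSpace.basisFun (Fin d) ℝ).toBasis,
    LinearMap.toMatrix_adjoint, Matrix.det_conjTranspose, LinearMap.det_toMatrix, star_trivial]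

lemma norm_fourierInv_comp_affine_s12 {d : ℕ} (G : Euc d → ℂ) (A : Euc d ≃L[ℝ] Euc d) (x ξ : Euc d) :
    ‖𝓕⁻ (fun y => G (A (y - x))) ξ‖ = |LinearMap.det (A : Euc d →ₗ[ℝ] Euc d)|⁻¹ *
      ‖𝓕⁻ G (LinearMap.adjoint (A.symm : Euc d →ₗ[ℝ] Euc d) ξ)‖ := by
  have hdet : LinearMap.det (A : Euc d →ₗ[ℝ] Euc d) ≠ 0 :=
    (LinearEquiv.isUnit_det' A.toLinearEquiv).ne_zero
  have h1 : ∫ y, Real.fourierChar (inner ℝ y ξ) • G (A (y - x)) =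
      Real.fourierChar (inner ℝ x ξ) • ∫ y, Real.fourierChar (inner ℝ y ξ) • G (A y) := by
    rw [← integral_add_right_eq_self _ x, Circle.smul_def, ← integral_smul]
    refine integral_congr_ae (ae_of_all _ fun y => ?_)
    simp only [add_sub_cancel_right]
    rw [inner_add_left, add_comm, AddChar.map_add_eq_mul, mul_smul, ← Circle.smul_def]
  have h2 : ∫ y, Real.fourierChar (inner ℝ y ξ) • G (A y) =
      |LinearMap.det (A : Euc d →ₗ[ℝ] Euc d)|⁻¹ • ∫ z, Real.fourierChar
        (inner ℝ z (LinearMap.adjoint (A.symm : Euc d →ₗ[ℝ] Euc d) ξ)) • G z := by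
    have h3 := Measure.map_linearMap_addHaar_eq_smul_addHaar (volume : Measure (Euc d)) hdet
    have h4 := A.toHomeomorph.measurableEmbedding.integral_map (μ := volume)
      (fun z => Real.fourierChar
        (inner ℝ z (LinearMap.adjoint (A.symm : Euc d →ₗ[ℝ] Euc d) ξ)) • G z)
    have h5 : Measure.map A.toHomeomorph (volume : Measure (Euc d)) =
      Measure.map (A : Euc d →ₗ[ℝ] Euc d) volume := rfl
    rw [h5, h3, integral_smul_measure, ENNReal.toReal_ofReal (abs_nonneg _), abs_inv] at h4
    rw [h4]
    refine integral_congr_ae (ae_of_all _ fun y => ?_)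
    simp only [LinearMap.adjoint_inner_right]
    simp
  rw [Real.fourierInv_eq, h1, Circle.norm_smul, h2, norm_smul, Real.norm_of_nonneg (by positivity),
    Real.fourierInv_eq]

/-- A restriction estimate at the endpoint controls the measure of every affine image of a ball
by a power of its volume. -/
lemma exists_measure_affine_le {d : ℕ} (hd : 0 < d) {s p q C : ℝ} (hs : 0 < s) (hp : 1 < p)
    {μ : Measure (Euc d)} (hq : q = s / d * (p / (p - 1))) (h : HasRestriction μ p q C) {ρ : ℝ}
    (hρ : 0 < ρ) :
    ∃ K : ℝ≥0∞, K ≠ ∞ ∧ ∀ (A : Euc d ≃L[ℝ] Euc d) (x : Euc d),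
      μ {y | ‖A (y - x)‖ ≤ ρ} ≤
        K * ENNReal.ofReal |LinearMap.det (A : Euc d →ₗ[ℝ] Euc d)| ^ (-(s / d)) := by
  have hd' : (0 : ℝ) < d := Nat.cast_pos.2 hd
  have hp0 : 0 < p - 1 := sub_pos.2 hp
  have hq0 : 0 < q := by
    rw [hq]
    exact mul_pos (div_pos hs hd') (div_pos (by linarith) hp0)
  let b : ContDiffBump (0 : Euc d) := ⟨ρ, ρ + 1, hρ, by linarith⟩
  have hbc : HasCompactSupport fun y => (b y : ℂ) :=
    b.hasCompactSupport.comp_left Complex.ofReal_zero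
  obtain ⟨g, hg⟩ : ∃ g : 𝓢(Euc d, ℂ), ∀ y, g y = b y :=
    ⟨hbc.toSchwartzMap (Complex.ofRealCLM.contDiff.comp b.contDiff), fun y => rfl⟩
  refine ⟨(ENNReal.ofReal C * eLpNorm (𝓕⁻ (g : Euc d → ℂ)) (ENNReal.ofReal p) volume) ^ q, ?_, ?_⟩
  · refine ENNReal.rpow_ne_top_of_nonneg hq0.le (ENNReal.mul_ne_top ENNReal.ofReal_ne_top ?_)
    rw [← SchwartzMap.fourierInv_coe g]
    exact ((𝓕⁻ g : 𝓢(Euc d, ℂ)).eLpNorm_lt_top (ENNReal.ofReal p) volume).ne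
  intro A x
  have hdet : LinearMap.det (A : Euc d →ₗ[ℝ] Euc d) ≠ 0 :=
    (LinearEquiv.isUnit_det' A.toLinearEquiv).ne_zero
  set D := |LinearMap.det (A : Euc d →ₗ[ℝ] Euc d)| with hD
  have hD0 : 0 < D := abs_pos.2 hdet
  obtain ⟨k, hk⟩ : ∃ k : 𝓢(Euc d, ℂ), (k : Euc d → ℂ) = fun y => g (A (y - x)) := by
    refine ⟨SchwartzMap.compSubConstCLM ℂ x (SchwartzMap.compCLMOfContinuousLinearEquiv ℂ A g), ?_⟩
    ext y
    rw [SchwartzMap.compSubConstCLM_apply, SchwartzMap.compCLMOfContinuousLinearEquiv_apply]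
    rfl
  have e0 : 𝓕 ((𝓕⁻ k : 𝓢(Euc d, ℂ)) : Euc d → ℂ) = k := by
    have : (𝓕 (𝓕⁻ k : 𝓢(Euc d, ℂ)) : 𝓢(Euc d, ℂ)) = k := FourierTransform.fourier_fourierInv_eq k
    rw [← SchwartzMap.fourier_coe (𝓕⁻ k : 𝓢(Euc d, ℂ)), this]
  have h1 := h (𝓕⁻ k)
  rw [e0, SchwartzMap.fourierInv_coe] at h1
  set B : Euc d →ₗ[ℝ] Euc d := LinearMap.adjoint (A.symm : Euc d →ₗ[ℝ] Euc d) with hB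
  have hdetB : LinearMap.det B = (LinearMap.det (A : Euc d →ₗ[ℝ] Euc d))⁻¹ := by
    rw [hB, det_adjoint_eq]
    exact LinearEquiv.det_coe_symm A.toLinearEquiv
  have h2 : eLpNorm (𝓕⁻ (k : Euc d → ℂ)) (ENNReal.ofReal p) volume =
      ENNReal.ofReal D⁻¹ * (ENNReal.ofReal D ^ p⁻¹ *
        eLpNorm (𝓕⁻ (g : Euc d → ℂ)) (ENNReal.ofReal p) volume) := by
    have e1 : eLpNorm (𝓕⁻ (k : Euc d → ℂ)) (ENNReal.ofReal p) volume =
        eLpNorm (D⁻¹ • (𝓕⁻ (g : Euc d → ℂ) ∘ B)) (ENNReal.ofReal p) volume := by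
      refine eLpNorm_congr_norm_ae (ae_of_all _ fun ξ => ?_)
      rw [hk, norm_fourierInv_comp_affine_s12, Pi.smul_apply, norm_smul, Real.norm_of_nonneg
        (inv_nonneg.2 hD0.le)]
      rfl
    have hcont : Continuous (𝓕⁻ (g : Euc d → ℂ)) := by
      rw [← SchwartzMap.fourierInv_coe g]
      exact (𝓕⁻ g : 𝓢(Euc d, ℂ)).continuous
    rw [e1, eLpNorm_const_smul, ← eLpNorm_map_measure hcont.aestronglyMeasurable
      B.continuous_of_finiteDimensional.aemeasurable,
      Measure.map_linearMap_addHaar_eq_smul_addHaar _ (by rw [hdetB]; exact inv_ne_zero hdet),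
      eLpNorm_smul_measure_of_ne_top ENNReal.ofReal_ne_top, hdetB, inv_inv, smul_eq_mul,
      one_div, ENNReal.toReal_inv, ENNReal.toReal_ofReal (by linarith),
      Real.enorm_eq_ofReal (inv_nonneg.2 hD0.le)]
  have h3 : μ {y | ‖A (y - x)‖ ≤ ρ} ≤ eLpNorm (k : Euc d → ℂ) (ENNReal.ofReal q) μ ^ q := by
    have e1 := mul_meas_ge_le_pow_eLpNorm (p := ENNReal.ofReal q) μ (by simpa using hq0)
      ENNReal.ofReal_ne_top (f := k) k.continuous.aestronglyMeasurable 1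
    rw [one_mul, ENNReal.toReal_ofReal hq0.le] at e1
    refine (measure_mono fun y hy => ?_).trans e1
    have e2 : k y = 1 := by
      rw [hk]
      simp only [hg]
      rw [b.one_of_mem_closedBall (by simpa using hy)]
      simp
    simp [e2]
  refine h3.trans ((ENNReal.rpow_le_rpow h1 hq0.le).trans (le_of_eq ?_))
  have hDne : ENNReal.ofReal D ≠ 0 := by simpa using hD0
  have h4 : ENNReal.ofReal D⁻¹ * ENNReal.ofReal D ^ p⁻¹ = ENNReal.ofReal D ^ (-1 + p⁻¹) := by
    rw [ENNReal.rpow_add _ _ hDne ENNReal.ofReal_ne_top, ENNReal.rpow_neg_one,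
      ENNReal.ofReal_inv_of_pos hD0]
  rw [h2, ← mul_assoc (ENNReal.ofReal D⁻¹), h4, mul_left_comm, mul_comm,
    ENNReal.mul_rpow_of_nonneg _ _ hq0.le, ← ENNReal.rpow_mul]
  congr 2
  rw [hq]
  field_simp
  ring

/-- The slab of width `N` around the hyperplane `y i = 0`, thickened along the line `ℝ v`. -/
def tube {d : ℕ} (i : Fin d) (v : Euc d) (N : ℝ) : Set (Euc d) :=
  {y | ‖y - y i • v‖ ≤ 2 + ‖v‖ ∧ |y i| ≤ 2 * N}

lemma isClosed_tube {d : ℕ} (i : Fin d) (v : Euc d) (N : ℝ) : IsClosed (tube i v N) := by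
  have h1 : Continuous fun y : Euc d => ‖y - y i • v‖ := by fun_prop
  have h2 : Continuous fun y : Euc d => |y i| := by fun_prop
  exact (isClosed_le h1 continuous_const).inter (isClosed_le h2 continuous_const)

lemma tube_subset_closedBall {d : ℕ} (i : Fin d) (v : Euc d) (N : ℝ) :
    tube i v N ⊆ closedBall 0 (2 + ‖v‖ + 2 * N * ‖v‖) := by
  intro y hy
  rw [mem_closedBall_zero_iff]
  calc ‖y‖ = ‖(y - y i • v) + y i • v‖ := by rw [sub_add_cancel]
    _ ≤ ‖y - y i • v‖ + |y i| * ‖v‖ := by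
      rw [← Real.norm_eq_abs, ← norm_smul]; exact norm_add_le _ _
    _ ≤ _ := add_le_add hy.1 (mul_le_mul_of_nonneg_right hy.2 (norm_nonneg _))

/-- A continuous plateau function on the line. -/
def plateau (t : ℝ) : ℝ := max 0 (min 1 (2 - |t|))

lemma continuous_plateau : Continuous plateau := by unfold plateau; fun_prop

lemma plateau_nonneg (t : ℝ) : 0 ≤ plateau t := le_max_left _ _

lemma plateau_le_one (t : ℝ) : plateau t ≤ 1 := max_le zero_le_one (min_le_left _ _)

lemma plateau_eq_one {t : ℝ} (ht : |t| ≤ 1) : plateau t = 1 := by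
  rw [plateau, min_eq_left (by linarith), max_eq_right zero_le_one]

lemma plateau_eq_zero {t : ℝ} (ht : 2 ≤ |t|) : plateau t = 0 :=
  max_eq_left ((min_le_right _ _).trans (by linarith))

/-- A test function whose derivative along `v` is at least one on the unit ball, up to an error of
size `N⁻¹` on a tube of width `N`. -/
lemma exists_contDiff_le_fderiv {d : ℕ} {i : Fin d} {v : Euc d} (hv : v i = 1) {N : ℝ}
    (hN : 1 ≤ N) : ∃ ψ : Euc d → ℝ, ContDiff ℝ 1 ψ ∧ (∀ y, y ∉ tube i v N → ψ y = 0) ∧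
      ∀ y, (closedBall 0 1).indicator 1 y ≤
        fderiv ℝ ψ y v + N⁻¹ * (tube i v N).indicator 1 y := by
  have hN0 : 0 < N := one_pos.trans_le hN
  let χ : ContDiffBump (0 : Euc d) := ⟨1 + ‖v‖, 2 + ‖v‖, by positivity, by linarith⟩
  let B : ℝ → ℝ := fun t => ∫ s in (0 : ℝ)..t, plateau s
  have hB : ∀ t, HasDerivAt B (plateau t) t := fun t =>
    intervalIntegral.integral_hasDerivAt_right (continuous_plateau.intervalIntegrable _ _)
      continuous_plateau.stronglyMeasurable.stronglyMeasurableAtFilter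
      continuous_plateau.continuousAt
  have hBc : ContDiff ℝ 1 B := by
    refine contDiff_one_iff_deriv.2 ⟨fun t => (hB t).differentiableAt, ?_⟩
    rw [show deriv B = plateau from funext fun t => (hB t).deriv]
    exact continuous_plateau
  have hi : ContDiff ℝ 1 fun y : Euc d => y i :=
    (EuclideanSpace.proj i : Euc d →L[ℝ] ℝ).contDiff
  let ψ : Euc d → ℝ := fun y => (B (y i) - B (N⁻¹ * y i)) * χ (y - y i • v)
  have hψ : ContDiff ℝ 1 ψ := by
    refine ((hBc.comp hi).sub (hBc.comp (contDiff_const.mul hi))).mul ?_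
    exact χ.contDiff.comp (contDiff_id.sub (hi.smul contDiff_const))
  have hχ : ∀ y, 2 + ‖v‖ ≤ ‖y‖ → χ y = 0 := fun y hy =>
    χ.zero_of_le_dist (by simpa using hy)
  have hlarge : ∀ t, 2 * N < |t| → B t - B (N⁻¹ * t) = 0 := by
    intro t ht
    rw [intervalIntegral.integral_interval_sub_left (continuous_plateau.intervalIntegrable _ _)
      (continuous_plateau.intervalIntegrable _ _)]
    rw [intervalIntegral.integral_congr (g := fun _ => 0), intervalIntegral.integral_zero]
    intro s hs
    refine plateau_eq_zero ?_
    have hN1 : N⁻¹ ≤ 1 := inv_le_one_of_one_le₀ hN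
    rcases le_total 0 t with h0 | h0
    · rw [abs_of_nonneg h0] at ht
      have h1 : 2 ≤ N⁻¹ * t := by rw [le_inv_mul_iff₀ hN0]; linarith
      have h2 : N⁻¹ * t ≤ t := mul_le_of_le_one_left h0 hN1
      rw [Set.uIcc_of_le h2] at hs
      exact (h1.trans hs.1).trans (le_abs_self s)
    · rw [abs_of_nonpos h0] at ht
      have h1 : 2 ≤ N⁻¹ * -t := by rw [le_inv_mul_iff₀ hN0]; linarith
      have h2 : t ≤ N⁻¹ * t := by
        have := mul_le_of_le_one_left (neg_nonneg.2 h0) hN1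
        linarith
      rw [Set.uIcc_of_ge h2] at hs
      have := hs.2
      have := neg_le_abs s
      linarith
  have hderiv : ∀ y, fderiv ℝ ψ y v =
      (plateau (y i) - N⁻¹ * plateau (N⁻¹ * y i)) * χ (y - y i • v) := by
    intro y
    rw [← ((hψ.differentiable one_ne_zero) y).lineDeriv_eq_fderiv, lineDeriv]
    refine HasDerivAt.deriv ?_
    have e : (fun t : ℝ => ψ (y + t • v)) =
        fun t => (B (y i + t) - B (N⁻¹ * (y i + t))) * χ (y - y i • v) := by
      funext t
      have h1 : (y + t • v) i = y i + t := by simp [hv]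
      simp only [ψ, h1]
      congr 2
      module
    rw [e]
    have h1 : HasDerivAt (fun t : ℝ => y i + t) 1 0 := (hasDerivAt_id 0).const_add _
    have h2 : HasDerivAt (fun t => B (y i + t)) (plateau (y i + 0) * 1) 0 :=
      (hB (y i + 0)).comp 0 h1
    have h3 : HasDerivAt (fun t => B (N⁻¹ * (y i + t)))
        (plateau (N⁻¹ * (y i + 0)) * (N⁻¹ * 1)) 0 :=
      HasDerivAt.comp (h₂ := B) 0 (hB (N⁻¹ * (y i + 0))) (h1.const_mul N⁻¹)
    refine ((h2.sub h3).mul_const _).congr_deriv ?_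
    simp only [add_zero]
    ring
  refine ⟨ψ, hψ, fun y hy => ?_, fun y => ?_⟩
  · by_cases h1 : ‖y - y i • v‖ ≤ 2 + ‖v‖
    · have : 2 * N < |y i| := by
        by_contra h2
        exact hy ⟨h1, not_lt.1 h2⟩
      simp only [ψ, hlarge _ this, zero_mul]
    · simp only [ψ, hχ _ (not_le.1 h1).le, mul_zero]
  · rw [hderiv]
    have h1 : (closedBall (0 : Euc d) 1).indicator 1 y ≤ plateau (y i) * χ (y - y i • v) := by
      by_cases hy : y ∈ closedBall (0 : Euc d) 1
      · rw [mem_closedBall_zero_iff] at hy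
        have hyi : |y i| ≤ 1 := (PiLp.norm_apply_le y i).trans hy
        rw [plateau_eq_one hyi, χ.one_of_mem_closedBall, mul_one]
        · exact Set.indicator_le_self' (fun _ _ => zero_le_one) y
        · rw [mem_closedBall_zero_iff]
          refine (norm_sub_le _ _).trans (add_le_add hy ?_)
          rw [norm_smul]
          exact mul_le_of_le_one_left (norm_nonneg _) hyi
      · rw [Set.indicator_of_notMem hy]
        exact mul_nonneg (plateau_nonneg _) χ.nonneg
    have h2 : plateau (N⁻¹ * y i) * χ (y - y i • v) ≤ (tube i v N).indicator 1 y := by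
      by_cases hy : y ∈ tube i v N
      · rw [Set.indicator_of_mem hy]
        exact mul_le_one₀ (plateau_le_one _) χ.nonneg χ.le_one
      · rw [Set.indicator_of_notMem hy]
        by_cases h1 : ‖y - y i • v‖ ≤ 2 + ‖v‖
        · have h2 : 2 * N < |y i| := by
            by_contra h2
            exact hy ⟨h1, not_lt.1 h2⟩
          rw [plateau_eq_zero, zero_mul]
          rw [abs_mul, abs_inv, abs_of_pos hN0, le_inv_mul_iff₀ hN0]
          linarith
        · rw [hχ _ (not_le.1 h1).le, mul_zero]
    have h3 := mul_le_mul_of_nonneg_left h2 (inv_nonneg.2 hN0.le)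
    linarith

/-- The mass of small balls is controlled by a blow-up and the mass of a tube. -/
lemma measureReal_closedBall_le {d : ℕ} {i : Fin d} {v : Euc d} {μ : Measure (Euc d)}
    [IsLocallyFiniteMeasure μ] {N R : ℝ} {ψ : Euc d → ℝ} (hψ : ContDiff ℝ 1 ψ)
    (hψ0 : ∀ y, y ∉ closedBall 0 R → ψ y = 0)
    (hψv : ∀ y, (closedBall 0 1).indicator 1 y ≤
        fderiv ℝ ψ y v + N⁻¹ * (tube i v N).indicator 1 y) (x : Euc d) {r : ℝ} (hr : 0 < r) :
    μ.real (closedBall x r) ≤ blowup μ μ x R (fun y => fderiv ℝ ψ y v) r *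
      μ.real (closedBall x (R * r)) + N⁻¹ * μ.real {y | r⁻¹ • (y - x) ∈ tube i v N} := by
  have hT : IsClosed {y | r⁻¹ • (y - x) ∈ tube i v N} :=
    (isClosed_tube i v N).preimage (by fun_prop)
  have hTb : {y | r⁻¹ • (y - x) ∈ tube i v N} ⊆
      closedBall x ((2 + ‖v‖ + 2 * N * ‖v‖) * r) := fun y hy =>
    mem_closedBall_of_rescale hr (tube_subset_closedBall i v N hy)
  have hTf : μ {y | r⁻¹ • (y - x) ∈ tube i v N} < ∞ :=
    (measure_mono hTb).trans_lt (isCompact_closedBall _ _).measure_lt_top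
  have hB : μ (closedBall x r) < ∞ := (isCompact_closedBall _ _).measure_lt_top
  have hg : Continuous fun y => fderiv ℝ ψ (r⁻¹ • (y - x)) v :=
    ((hψ.continuous_fderiv one_ne_zero).clm_apply continuous_const).comp
      (f := fun y => r⁻¹ • (y - x)) (by fun_prop)
  have hG0 : ∀ y, y ∉ closedBall 0 R → fderiv ℝ ψ y v = 0 := by
    intro y hy
    have : ψ =ᶠ[nhds y] fun _ => 0 := by
      filter_upwards [isClosed_closedBall.isOpen_compl.mem_nhds hy] with z hz using hψ0 z hz
    rw [this.fderiv_eq]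
    simp
  have hg0 : ∀ y, y ∉ closedBall x (R * r) → fderiv ℝ ψ (r⁻¹ • (y - x)) v = 0 := fun y hy =>
    hG0 _ fun h => hy (mem_closedBall_of_rescale hr h)
  have hgi : Integrable (fun y => fderiv ℝ ψ (r⁻¹ • (y - x)) v) μ :=
    hg.integrable_of_hasCompactSupport (HasCompactSupport.intro (isCompact_closedBall _ _) hg0)
  have e1 : blowup μ μ x R (fun y => fderiv ℝ ψ y v) r * μ.real (closedBall x (R * r)) =
      ∫ y, fderiv ℝ ψ (r⁻¹ • (y - x)) v ∂μ := by
    by_cases h0 : μ.real (closedBall x (R * r)) = 0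
    · rw [h0, mul_zero, ← setIntegral_eq_integral_of_forall_compl_eq_zero hg0,
        setIntegral_measure_zero]
      exact (measureReal_eq_zero_iff (isCompact_closedBall _ _).measure_lt_top.ne).1 h0
    · exact div_mul_cancel₀ _ h0
  rw [e1, ← integral_indicator_one hT.measurableSet,
    ← integral_indicator_one isClosed_closedBall.measurableSet, ← integral_const_mul,
    ← integral_add hgi]
  · refine integral_mono ?_ (hgi.add ?_) fun y => ?_
    · exact (integrable_indicator_iff isClosed_closedBall.measurableSet).2
        (integrableOn_const hB.ne)
    · exact ((integrable_indicator_iff hT.measurableSet).2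
        (integrableOn_const hTf.ne)).const_mul _
    · refine le_trans (le_of_eq ?_) (hψv (r⁻¹ • (y - x)))
      have : y ∈ closedBall x r ↔ r⁻¹ • (y - x) ∈ closedBall (0 : Euc d) 1 := by
        rw [mem_closedBall_zero_iff, norm_smul, norm_inv, Real.norm_of_nonneg hr.le,
          inv_mul_le_iff₀ hr, mul_one, mem_closedBall, dist_eq_norm]
      by_cases hy : y ∈ closedBall x r
      · rw [Set.indicator_of_mem hy, Set.indicator_of_mem (this.1 hy)]; rfl
      · rw [Set.indicator_of_notMem hy, Set.indicator_of_notMem fun h => hy (this.2 h)]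
  · exact ((integrable_indicator_iff hT.measurableSet).2
      (integrableOn_const hTf.ne)).const_mul _

/-- Measures with tubes of small mass have no blow-up invariant in the direction `v`. -/
lemma not_forall_tendsto_blowup {d : ℕ} {i : Fin d} {v : Euc d} (hv : v i = 1)
    {μ : Measure (Euc d)} [IsLocallyFiniteMeasure μ] {x : Euc d} {s c Θ L θ : ℝ} (hc : 0 < c)
    (hθ : θ < 1)
    (hlow : ∃ᶠ r in nhdsWithin 0 (Set.Ioi 0), c * r ^ s ≤ μ.real (closedBall x r))
    (hup : ∀ᶠ r in nhdsWithin 0 (Set.Ioi 0), μ.real (closedBall x r) ≤ Θ * r ^ s)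
    (htube : ∀ N : ℝ, 1 ≤ N → ∀ᶠ r in nhdsWithin 0 (Set.Ioi 0),
      μ.real {y | r⁻¹ • (y - x) ∈ tube i v N} ≤ L * N ^ θ * r ^ s)
    (H : ∀ (R : ℝ) (ψ : Euc d → ℝ), 0 < R → ContDiff ℝ 1 ψ →
      (∀ y, y ∉ closedBall 0 R → ψ y = 0) →
      Tendsto (blowup μ μ x R fun y => fderiv ℝ ψ y v) (nhdsWithin 0 (Set.Ioi 0)) (nhds 0)) :
    False := by
  obtain ⟨N, hN, hNc⟩ : ∃ N : ℝ, 1 ≤ N ∧ L * N ^ (θ - 1) < c / 2 := by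
    have h1 : Tendsto (fun N : ℝ => L * N ^ (θ - 1)) atTop (nhds (L * 0)) := by
      have := tendsto_rpow_neg_atTop (sub_pos.2 hθ)
      rw [neg_sub] at this
      exact this.const_mul L
    rw [mul_zero] at h1
    exact ((eventually_ge_atTop 1).and (h1.eventually_lt_const (half_pos hc))).exists
  have hN0 : 0 < N := one_pos.trans_le hN
  obtain ⟨ψ, hψ, hψ0, hψv⟩ := exists_contDiff_le_fderiv hv hN
  set R := 2 + ‖v‖ + 2 * N * ‖v‖ with hRdef
  have hR : 0 < R := by positivity
  have hψ1 : ∀ y, y ∉ closedBall 0 R → ψ y = 0 := fun y hy =>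
    hψ0 y fun h => hy (tube_subset_closedBall i v N h)
  have hbl := H R ψ hR hψ hψ1
  have h1 : Tendsto (fun r => |blowup μ μ x R (fun y => fderiv ℝ ψ y v) r| * (Θ * R ^ s))
      (nhdsWithin 0 (Set.Ioi 0)) (nhds (|0| * (Θ * R ^ s))) := hbl.abs.mul_const _
  rw [abs_zero, zero_mul] at h1
  obtain ⟨r, hr1, hr2, hr3, hr4, hr0⟩ := (hlow.and_eventually
    ((htube N hN).and ((h1.eventually_lt_const (half_pos hc)).and
      (((tendsto_const_mul_nhdsGT_zero hR).eventually hup).and self_mem_nhdsWithin)))).exists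
  have hr : 0 < r := hr0
  have hrs : 0 < r ^ s := Real.rpow_pos_of_pos hr s
  have key := measureReal_closedBall_le (μ := μ) hψ hψ1 hψv x hr
  rw [Real.mul_rpow hR.le hr.le] at hr4
  have h2 : blowup μ μ x R (fun y => fderiv ℝ ψ y v) r * μ.real (closedBall x (R * r)) ≤
      c / 2 * r ^ s :=
    calc _ ≤ |blowup μ μ x R (fun y => fderiv ℝ ψ y v) r| * (Θ * (R ^ s * r ^ s)) :=
          mul_le_mul (le_abs_self _) hr4 measureReal_nonneg (abs_nonneg _)
      _ = |blowup μ μ x R (fun y => fderiv ℝ ψ y v) r| * (Θ * R ^ s) * r ^ s := by ring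
      _ ≤ _ := mul_le_mul_of_nonneg_right hr3.le hrs.le
  have h3 : N⁻¹ * μ.real {y | r⁻¹ • (y - x) ∈ tube i v N} < c / 2 * r ^ s :=
    calc _ ≤ N⁻¹ * (L * N ^ θ * r ^ s) :=
          mul_le_mul_of_nonneg_left hr2 (inv_nonneg.2 hN0.le)
      _ = L * N ^ (θ - 1) * r ^ s := by
          rw [Real.rpow_sub_one hN0.ne']; ring
      _ < _ := mul_lt_mul_of_pos_right hNc hrs
  linarith

/-- Tubes have small mass for measures satisfying the endpoint restriction estimate. -/
lemma exists_measureReal_tube_le {d : ℕ} {μ : Measure (Euc d)} [IsLocallyFiniteMeasure μ]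
    {s p q C : ℝ} {i : Fin d} {v : Euc d} (hv : v i = 1) (hsd : s < d) (hp : 1 < p)
    (hq : q = s / d * (p / (p - 1))) (h : HasRestriction μ p q C) {x : Euc d} {Θ : ℝ}
    (hup : ∀ᶠ r in nhdsWithin 0 (Set.Ioi 0), μ.real (closedBall x r) ≤ Θ * r ^ s) :
    ∃ L θ : ℝ, θ < 1 ∧ ∀ N : ℝ, 1 ≤ N → ∀ᶠ r in nhdsWithin 0 (Set.Ioi 0),
      μ.real {y | r⁻¹ • (y - x) ∈ tube i v N} ≤ L * N ^ θ * r ^ s := by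
  have hd : 0 < d := i.pos
  have hd' : (0 : ℝ) < d := Nat.cast_pos.2 hd
  rcases le_or_gt s 0 with hs | hs
  · refine ⟨Θ, 0, one_pos, fun N hN => ?_⟩
    have hR : 1 ≤ 2 + ‖v‖ + 2 * N * ‖v‖ := by
      have := norm_nonneg v
      have : 0 ≤ 2 * N * ‖v‖ := by positivity
      linarith
    set R := 2 + ‖v‖ + 2 * N * ‖v‖ with hRdef
    have hR0 : 0 < R := one_pos.trans_le hR
    filter_upwards [(tendsto_const_mul_nhdsGT_zero hR0).eventually hup, self_mem_nhdsWithin, hup]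
      with r hr1 (hr : 0 < r) hr2
    have hΘ : 0 ≤ Θ :=
      nonneg_of_mul_nonneg_left (measureReal_nonneg.trans hr2) (Real.rpow_pos_of_pos hr s)
    have h1 : μ.real {y | r⁻¹ • (y - x) ∈ tube i v N} ≤ μ.real (closedBall x (R * r)) :=
      measureReal_mono (fun y hy =>
        mem_closedBall_of_rescale hr (tube_subset_closedBall i v N hy))
        (isCompact_closedBall _ _).measure_lt_top.ne
    refine h1.trans (hr1.trans ?_)
    rw [Real.rpow_zero, mul_one]
    refine mul_le_mul_of_nonneg_left ?_ hΘ
    exact Real.rpow_le_rpow_of_nonpos hr (le_mul_of_one_le_left hr.le hR) hs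
  · obtain ⟨K, hK, hKA⟩ := exists_measure_affine_le hd hs hp hq h
      (show 0 < 2 + 3 * ‖v‖ by positivity)
    refine ⟨K.toReal, s / d, (div_lt_one hd').2 hsd, fun N hN => ?_⟩
    have hN0 : 0 < N := one_pos.trans_le hN
    filter_upwards [self_mem_nhdsWithin] with r (hr : 0 < r)
    let f : Module.Dual ℝ (Euc d) :=
      (N⁻¹ - 1) • (EuclideanSpace.proj i : Euc d →L[ℝ] ℝ).toLinearMap
    let T : Euc d →ₗ[ℝ] Euc d := r⁻¹ • LinearMap.transvection f v
    have hdet : LinearMap.det T = r⁻¹ ^ d * N⁻¹ := by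
      have hf : f v = N⁻¹ - 1 := by simp [f, hv]
      rw [LinearMap.det_smul, LinearMap.transvection.det, hf, finrank_euclideanSpace_fin,
        add_sub_cancel]
    have hpos : 0 < r⁻¹ ^ d * N⁻¹ := by positivity
    have hdet0 : LinearMap.det T ≠ 0 := hdet ▸ hpos.ne'
    let A : Euc d ≃L[ℝ] Euc d := (T.equivOfDetNeZero hdet0).toContinuousLinearEquiv
    have hA : ∀ z, A z = r⁻¹ • (z + ((N⁻¹ - 1) * z i) • v) := fun z => by
      change T z = _
      simp [T, f, LinearMap.transvection.apply]
    have hAT : (A : Euc d →ₗ[ℝ] Euc d) = T := rfl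
    have h1 := hKA A x
    rw [hAT, hdet, abs_of_pos hpos] at h1
    have hsub : {y | r⁻¹ • (y - x) ∈ tube i v N} ⊆ {y | ‖A (y - x)‖ ≤ 2 + 3 * ‖v‖} := by
      intro y hy
      obtain ⟨hy1, hy2⟩ := hy
      set z := r⁻¹ • (y - x) with hz
      have e : A (y - x) = (z - z i • v) + (N⁻¹ * z i) • v := by
        rw [hA, hz]
        simp only [PiLp.smul_apply, smul_eq_mul]
        module
      have h2 : ‖(N⁻¹ * z i) • v‖ ≤ 2 * ‖v‖ := by
        rw [norm_smul, norm_mul, norm_inv, Real.norm_of_nonneg hN0.le, Real.norm_eq_abs]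
        refine mul_le_mul_of_nonneg_right ?_ (norm_nonneg _)
        rw [inv_mul_le_iff₀ hN0]
        linarith
      change ‖A (y - x)‖ ≤ _
      rw [e]
      have := norm_add_le (z - z i • v) ((N⁻¹ * z i) • v)
      linarith
    have h2 : ENNReal.ofReal (r⁻¹ ^ d * N⁻¹) ^ (-(s / d)) =
        ENNReal.ofReal (N ^ (s / d) * r ^ s) := by
      rw [ENNReal.ofReal_rpow_of_pos hpos]
      congr 1
      rw [Real.mul_rpow (by positivity) (by positivity), ← Real.rpow_natCast, ← Real.rpow_mul
        (by positivity), Real.inv_rpow hr.le, Real.inv_rpow hN0.le, ← Real.rpow_neg hr.le,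
        ← Real.rpow_neg hN0.le, neg_neg, mul_comm]
      congr 2
      field_simp
    rw [h2] at h1
    have h3 := (measure_mono hsub).trans h1
    have h4 := ENNReal.toReal_mono (ENNReal.mul_ne_top hK ENNReal.ofReal_ne_top) h3
    rw [ENNReal.toReal_mul, ENNReal.toReal_ofReal (by positivity), ← mul_assoc] at h4
    exact h4

lemma eventually_measure_closedBall_le {d : ℕ} {μ : Measure (Euc d)} {s : ℝ} {x : Euc d}
    (h : upperDensity μ s x < ∞) : ∃ Θ : ℝ≥0, 0 < Θ ∧ ∀ᶠ r in nhdsWithin (0 : ℝ) (Set.Ioi 0),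
      μ (closedBall x r) ≤ Θ * ENNReal.ofReal (r ^ s) := by
  obtain ⟨Θ, hΘ, -⟩ := ENNReal.lt_iff_exists_nnreal_btwn.1 h
  have hΘ0 : 0 < Θ := ENNReal.coe_pos.1 (bot_le.trans_lt hΘ)
  refine ⟨Θ, hΘ0, ?_⟩
  filter_upwards [eventually_lt_of_limsup_lt hΘ, self_mem_nhdsWithin] with r hr (hr0 : 0 < r)
  have h1 : ENNReal.ofReal (r ^ s) ≠ 0 := by simpa using Real.rpow_pos_of_pos hr0 s
  exact (ENNReal.div_le_iff h1 ENNReal.ofReal_ne_top).1 hr.le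

lemma frequently_le_measure_closedBall {d : ℕ} {μ : Measure (Euc d)} [IsLocallyFiniteMeasure μ]
    {s : ℝ} {x : Euc d} (h : 0 < upperDensity μ s x) :
    ∃ c : ℝ, 0 < c ∧ ∃ᶠ r in nhdsWithin (0 : ℝ) (Set.Ioi 0),
      c * r ^ s ≤ μ.real (closedBall x r) := by
  obtain ⟨c, hc0, hc⟩ := ENNReal.lt_iff_exists_nnreal_btwn.1 h
  refine ⟨c, ENNReal.coe_pos.1 hc0, ?_⟩
  refine ((frequently_lt_of_lt_limsup (by isBoundedDefault) hc).and_eventually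
    self_mem_nhdsWithin).mono ?_
  rintro r ⟨hr, hr0 : 0 < r⟩
  have h1 : ENNReal.ofReal (r ^ s) ≠ 0 := by simpa using Real.rpow_pos_of_pos hr0 s
  have h2 := (ENNReal.le_div_iff_mul_le (Or.inl h1) (Or.inl ENNReal.ofReal_ne_top)).1 hr.le
  have h3 := ENNReal.toReal_mono (isCompact_closedBall x r).measure_lt_top.ne h2
  rwa [ENNReal.toReal_mul, ENNReal.toReal_ofReal (Real.rpow_pos_of_pos hr0 s).le] at h3

lemma inv_le_of_tendsto_div {d : ℕ} {ν : Measure (Euc d)} {x : Euc d} {ε l : ℝ≥0∞} (hε : ε ≠ ∞)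
    (hε0 : ε ≠ 0)
    (hν : ∀ᶠ r in nhdsWithin (0 : ℝ) (Set.Ioi 0), ν (closedBall x r) ≤ ε * volume (closedBall x r))
    (hl : Tendsto (fun r => volume (closedBall x r) / ν (closedBall x r))
      (nhdsWithin (0 : ℝ) (Set.Ioi 0)) (nhds l)) : ε⁻¹ ≤ l := by
  refine ge_of_tendsto hl ?_
  filter_upwards [hν, self_mem_nhdsWithin] with r hr (hr0 : 0 < r)
  have h0 : volume (closedBall x r) ≠ 0 := (measure_closedBall_pos _ _ hr0).ne'
  have htop : volume (closedBall x r) ≠ ∞ := measure_closedBall_lt_top.ne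
  refine le_trans (le_of_eq ?_) (ENNReal.div_le_div_left hr _)
  rw [ENNReal.div_eq_inv_mul, ENNReal.mul_inv (Or.inl hε0) (Or.inl hε), mul_assoc,
    ENNReal.inv_mul_cancel h0 htop, mul_one]

lemma eventually_measure_closedBall_le_volume {d : ℕ} {μ : Measure (Euc d)} {s : ℝ} {x : Euc d}
    (h : upperDensity μ s x < ∞) :
    ∃ Θ : ℝ≥0, 0 < Θ ∧ ∀ᶠ r in nhdsWithin (0 : ℝ) (Set.Ioi 0),
      μ (closedBall x r) ≤ Θ * ENNReal.ofReal (r ^ (s - d)) * volume (closedBall x r) := by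
  obtain ⟨Θ, hΘ, hr⟩ := eventually_measure_closedBall_le h
  have hpos : 0 < volume (ball (0 : Euc d) 1) := measure_ball_pos _ _ one_pos
  have hfin : volume (ball (0 : Euc d) 1) ≠ ∞ := measure_ball_lt_top.ne
  lift volume (ball (0 : Euc d) 1) to ℝ≥0 using hfin with κ hκ
  have hκ0 : 0 < κ := ENNReal.coe_pos.1 hpos
  refine ⟨Θ / κ, div_pos hΘ hκ0, ?_⟩
  filter_upwards [hr, self_mem_nhdsWithin] with r hr (hr0 : 0 < r)
  refine hr.trans (le_of_eq ?_)
  rw [Measure.addHaar_closedBall _ _ hr0.le, ← hκ, finrank_euclideanSpace_fin,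
    ENNReal.coe_div hκ0.ne']
  have e : ENNReal.ofReal (r ^ s) = ENNReal.ofReal (r ^ (s - d)) * ENNReal.ofReal (r ^ d) := by
    rw [← ENNReal.ofReal_mul (by positivity), ← Real.rpow_natCast r d, ← Real.rpow_add hr0,
      sub_add_cancel]
  have e' : (Θ : ℝ≥0∞) = Θ / κ * κ :=
    (ENNReal.div_mul_cancel (ENNReal.coe_ne_zero.2 hκ0.ne') ENNReal.coe_ne_top).symm
  rw [e]
  nth_rw 1 [e']
  ring

lemma eq_zero_of_upperDensity_lt_top {d : ℕ} {μ : Measure (Euc d)} [IsLocallyFiniteMeasure μ]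
    {s : ℝ} (hs : (d : ℝ) < s) (h : ∀ᵐ x ∂μ, upperDensity μ s x < ∞) : μ = 0 := by
  rw [← ae_eq_bot, ← empty_mem_iff_bot]
  filter_upwards [h, Besicovitch.ae_tendsto_rnDeriv volume μ, Measure.rnDeriv_lt_top volume μ]
    with x hx hx1 hx2
  obtain ⟨Θ, hΘ, hr⟩ := eventually_measure_closedBall_le_volume hx
  obtain ⟨l, hl⟩ := ENNReal.lt_iff_exists_nnreal_btwn.1 hx2
  have hl0 : 0 < l := ENNReal.coe_pos.1 (bot_le.trans_lt hl.1)
  have h1 : Tendsto (fun r : ℝ => Θ * ENNReal.ofReal (r ^ (s - d))) (nhdsWithin 0 (Set.Ioi 0))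
      (nhds 0) := by
    have h2 : Tendsto (fun r : ℝ => r ^ (s - d)) (nhds 0) (nhds (0 ^ (s - d))) :=
      (Real.continuousAt_rpow_const 0 (s - d) (Or.inr (sub_pos.2 hs).le)).tendsto
    rw [Real.zero_rpow (sub_pos.2 hs).ne'] at h2
    have h3 := ENNReal.Tendsto.const_mul (a := Θ) (ENNReal.tendsto_ofReal
      (h2.mono_left (nhdsWithin_le_nhds (s := Set.Ioi 0)))) (Or.inr ENNReal.coe_ne_top)
    simpa using h3
  have hl1 : (l : ℝ≥0∞)⁻¹ ≠ 0 := ENNReal.inv_ne_zero.2 ENNReal.coe_ne_top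
  have h2 := inv_le_of_tendsto_div (ε := (l : ℝ≥0∞)⁻¹) (by simpa using hl0.ne') hl1 ?_ hx1
  · rw [inv_inv] at h2
    exact absurd hl.1 h2.not_gt
  · filter_upwards [hr, h1.eventually_lt_const (pos_iff_ne_zero.2 hl1)] with r hr1 hr2
    exact hr1.trans (by gcongr)

lemma absolutelyContinuous_of_upperDensity_lt_top {d : ℕ} {μ : Measure (Euc d)}
    [IsLocallyFiniteMeasure μ] (h : ∀ᵐ x ∂μ, upperDensity μ d x < ∞) :
    μ ≪ (volume : Measure (Euc d)) := by
  rw [← Measure.singularPart_eq_zero]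
  set ρ := μ.singularPart volume with hρ
  have hle : ρ ≤ μ := Measure.singularPart_le _ _
  rw [← ae_eq_bot, ← empty_mem_iff_bot]
  filter_upwards [hle.absolutelyContinuous.ae_le h,
    (Besicovitch.vitaliFamily ρ).ae_eventually_measure_zero_of_singular
      (Measure.mutuallySingular_singularPart μ volume).symm] with x hx hx1
  obtain ⟨Θ, hΘ, hr⟩ := eventually_measure_closedBall_le_volume hx
  have h2 := inv_le_of_tendsto_div (ε := Θ) ENNReal.coe_ne_top (by simpa using hΘ.ne') ?_
    (hx1.comp (Besicovitch.tendsto_filterAt ρ x))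
  · simp at h2
  · filter_upwards [hr] with r hr
    refine (hle _).trans (hr.trans (le_of_eq ?_))
    simp

/-- In dimension `s < d` the measure is carried by a set which is null along all curves in a cone
around a coordinate direction. -/
lemma exists_null_along_cone_curves_of_hasRestriction {d : ℕ} {s p q C : ℝ} (hp : 1 < p)
    {μ : Measure (Euc d)} [IsLocallyFiniteMeasure μ]
    (hdens : ∀ᵐ x ∂μ, 0 < upperDensity μ s x ∧ upperDensity μ s x < ∞)
    (hq : q = s / d * (p / (p - 1))) (h : HasRestriction μ p q C) (hsd : s < d) (i : Fin d) :
    ∃ S : Set (Euc d), μ Sᶜ = 0 ∧ ∀ γ, IsConeCurve i γ → volume {t | γ t ∈ S} = 0 := by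
  suffices ∃ S : Set (Euc d), μ.toFinite Sᶜ = 0 ∧
      ∀ γ, IsConeCurve i γ → volume {t | γ t ∈ S} = 0 from
    let ⟨S, hS, hS'⟩ := this
    ⟨S, absolutelyContinuous_toFinite μ hS, hS'⟩
  refine exists_null_along_cone_curves i μ.toFinite ?_
  by_contra! H
  obtain ⟨ε, hε, H⟩ := H
  obtain ⟨P, c, l₁, l₂, hPl, hl₁, hl₂, hci, hP, hdiv⟩ := exists_measures_of_width hε
    fun u h α β h1 h2 h3 h4 => (H u h α β h1 h2 h3 h4).le
  have hP' : ¬ P i ⟂ₘ μ := fun hs =>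
    hP (hs.mono_ac Measure.AbsolutelyContinuous.rfl (toFinite_absolutelyContinuous μ))
  obtain ⟨x, ⟨v, hv, hx⟩, hx1, hx2⟩ :=
    ((exists_frequently_tendsto_blowup hci hP' hdiv).and_eventually hdens).exists
  obtain ⟨c, hc, hlow⟩ := frequently_le_measure_closedBall hx1
  obtain ⟨Θ, -, hup⟩ := eventually_measure_closedBall_le hx2
  have hup' : ∀ᶠ r in nhdsWithin (0 : ℝ) (Set.Ioi 0), μ.real (closedBall x r) ≤ Θ * r ^ s := by
    filter_upwards [hup, self_mem_nhdsWithin] with r hr (hr0 : 0 < r)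
    have h1 := ENNReal.toReal_mono (ENNReal.mul_ne_top ENNReal.coe_ne_top
      ENNReal.ofReal_ne_top) hr
    rwa [ENNReal.toReal_mul, ENNReal.toReal_ofReal (Real.rpow_pos_of_pos hr0 s).le] at h1
  obtain ⟨L, θ, hθ, htube⟩ := exists_measureReal_tube_le hv hsd hp hq h hup'
  exact not_forall_tendsto_blowup hv hc hθ hlow hup' htube hx

/-- Dichotomy for endpoint restriction estimates: if `0 < Θ^{*s}(μ,x) < ∞` for `μ`-a.e.
`x` and `R_μ(p → q)` holds at the endpoint `q = (s/d)p'` for some `p > 1`, then either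
`q = p'` and `μ ≪ L^d`, or `μ` is supported on a `1`-purely unrectifiable set. -/
theorem endpoint_restriction_dichotomy (d : ℕ) (s p q C : ℝ) (hp : 1 < p)
    (μ : Measure (Euc d)) [IsLocallyFiniteMeasure μ]
    (hdens : ∀ᵐ x ∂μ, 0 < upperDensity μ s x ∧ upperDensity μ s x < ∞)
    (hq : q = s / d * (p / (p - 1)))
    (h : HasRestriction μ p q C) :
    (q = p / (p - 1) ∧ μ ≪ (volume : Measure (Euc d))) ∨
    ∃ S : Set (Euc d), μ Sᶜ = 0 ∧
      ∀ φ : ℝ → Euc d, (∃ K : ℝ≥0, LipschitzWith K φ) →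
        μH[(1 : ℝ)] (S ∩ Set.range φ) = 0 := by
  rcases Nat.eq_zero_or_pos d with rfl | hd
  · exact Or.inr ⟨Set.univ, by simp, fun φ ⟨K, hφ⟩ =>
      hausdorffMeasure_inter_range_eq_zero (fun i => i.elim0) hφ⟩
  have hd' : (d : ℝ) ≠ 0 := Nat.cast_ne_zero.2 hd.ne'
  rcases lt_trichotomy s d with hsd | hsd | hsd
  · choose S hS hS' using exists_null_along_cone_curves_of_hasRestriction hp hdens hq h hsd
    refine Or.inr ⟨⋂ i, S i, ?_, fun φ ⟨K, hφ⟩ => hausdorffMeasure_inter_range_eq_zero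
      (fun i γ hγ => measure_mono_null (fun t ht => Set.iInter_subset S i ht) (hS' i γ hγ)) hφ⟩
    rw [Set.compl_iInter]
    exact measure_iUnion_null hS
  · subst hsd
    refine Or.inl ⟨by rw [hq, div_self hd', one_mul], ?_⟩
    exact absolutelyContinuous_of_upperDensity_lt_top (hdens.mono fun x hx => hx.2)
  · refine Or.inr ⟨∅, ?_, by simp⟩
    rw [eq_zero_of_upperDensity_lt_top hsd (hdens.mono fun x hx => hx.2)]
    rfl

end
end
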